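/- arXiv:0910.0547 — 4 statements merged into one kernel-verified Lean document; each statement's English description precedes it below -/
import Mathlib

section
/- For every multigraphon W, the multigraph parameter f(A) := t_≤(A,W) is normalized, multiplicative, non-defective, and reflection positive. -/
open scoped Classical BigOperators
open Filter MeasureTheory

/-- `A ∈ A_k`: adjacency matrix of a multigraph on `k` labeled vertices. -/
def IsAdj {k : ℕ} (A : Matrix (Fin k) (Fin k) ℕ) : Prop :=
  (∀ i j, A i j = A j i) ∧ ∀ i, Even (A i i)

/-- number of edges `e(A) = (1/2) ∑_{i,j} A i j`. -/
def numEdges {k : ℕ} (A : Matrix (Fin k) (Fin k) ℕ) : ℕ :=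
  (∑ i, ∑ j, A i j) / 2

/-- A multigraphon: a measurable `W : [0,1]×[0,1]×ℕ₀ → [0,1]` which is symmetric,
whose values at each point of `[0,1]²` sum to `1` over `ℕ₀`, and which vanishes on the
diagonal for odd multiplicities. -/
structure Multigraphon where
  W : ℝ → ℝ → ℕ → ℝ
  measurable : ∀ m : ℕ, Measurable fun p : ℝ × ℝ => W p.1 p.2 m
  nonneg : ∀ x y m, 0 ≤ W x y m
  le_one : ∀ x y m, W x y m ≤ 1
  symm : ∀ x y m, W x y m = W y x m
  sum_one : ∀ x ∈ Set.Icc (0:ℝ) 1, ∀ y ∈ Set.Icc (0:ℝ) 1, ∑' m : ℕ, W x y m = 1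
  diag_odd : ∀ x ∈ Set.Icc (0:ℝ) 1, ∀ m : ℕ, W x x (2 * m + 1) = 0

/-- `t_≤(A,W) = ∫_{[0,1]^k} ∏_{1≤i≤j≤k} (∑_{l=A(i,j)}^∞ W(x_i,x_j,l)) dx₁⋯dx_k`. -/
noncomputable def tleW {k : ℕ} (A : Matrix (Fin k) (Fin k) ℕ) (G : Multigraphon) : ℝ :=
  ∫ x : Fin k → ℝ in Set.univ.pi fun _ => Set.Icc (0:ℝ) 1,
    ∏ p ∈ Finset.univ.filter (fun p : Fin k × Fin k => p.1 ≤ p.2),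
      ∑' l : ℕ, G.W (x p.1) (x p.2) (A p.1 p.2 + l)

/-- Block-diagonal matrix `diag(A₁, A₂)`: the disjoint union of two multigraphs. -/
def blockDiag {k₁ k₂ : ℕ} (A₁ : Matrix (Fin k₁) (Fin k₁) ℕ)
    (A₂ : Matrix (Fin k₂) (Fin k₂) ℕ) : Matrix (Fin (k₁ + k₂)) (Fin (k₁ + k₂)) ℕ :=
  Matrix.submatrix (Matrix.fromBlocks A₁ 0 0 A₂) finSumFinEquiv.symm finSumFinEquiv.symm

/-- Extension of a matrix on `Fin m` to `ℕ × ℕ` by zero. -/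
def matExt {m : ℕ} (A : Matrix (Fin m) (Fin m) ℕ) : ℕ → ℕ → ℕ := fun i j =>
  if h : i < m ∧ j < m then A ⟨i, h.1⟩ ⟨j, h.2⟩ else 0

/-- Reindexing used for gluing: a vertex of `F₁F₂` (first the `k` labeled vertices, then the
`n₁` unlabeled vertices of `F₁`, then the `n₂` unlabeled vertices of `F₂`), viewed as a
vertex of `F₂`; vertices of `F₁ ∖ [k]` are sent out of range. -/
def glueIdx (k n₁ n₂ : ℕ) (i : ℕ) : ℕ :=
  if i < k then i else if k + n₁ ≤ i then i - n₁ else k + n₂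

/-- Gluing `A₁ ∨ A₂` of two `k`-labeled multigraphs (with `n₁`, resp. `n₂`, unlabeled
vertices): on pairs of labeled vertices it is the maximum of the two matrices, inside each
part it keeps the original matrix, and it vanishes across the two unlabeled parts. -/
def glue (k n₁ n₂ : ℕ) (A₁ : Matrix (Fin (k + n₁)) (Fin (k + n₁)) ℕ)
    (A₂ : Matrix (Fin (k + n₂)) (Fin (k + n₂)) ℕ) :
    Matrix (Fin (k + n₁ + n₂)) (Fin (k + n₁ + n₂)) ℕ :=
  Matrix.of fun i j =>
    max (matExt A₁ i j) (matExt A₂ (glueIdx k n₁ n₂ i) (glueIdx k n₁ n₂ j))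

open scoped Matrix

namespace Multigraphon

/-- The probability that the multiplicity at `(x, y)` is at least `a`, where both points are first
projected onto `[0,1]`. -/
noncomputable def tail (G : Multigraphon) (x y : ℝ) (a : ℕ) : ℝ :=
  1 - ∑ l ∈ Finset.range a,
    G.W (Set.projIcc 0 1 zero_le_one x) (Set.projIcc 0 1 zero_le_one y) l

theorem hasSum_one (G : Multigraphon) {x y : ℝ} (hx : x ∈ Set.Icc (0:ℝ) 1)
    (hy : y ∈ Set.Icc (0:ℝ) 1) : HasSum (G.W x y) 1 := by
  have h1 := G.sum_one x hx y hy
  have hs : Summable (G.W x y) := by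
    by_contra h
    rw [tsum_eq_zero_of_not_summable h] at h1
    exact zero_ne_one h1
  exact h1 ▸ hs.hasSum

theorem tsum_eq_tail (G : Multigraphon) {x y : ℝ} (hx : x ∈ Set.Icc (0:ℝ) 1)
    (hy : y ∈ Set.Icc (0:ℝ) 1) (a : ℕ) : ∑' l, G.W x y (a + l) = G.tail x y a := by
  have h := G.hasSum_one hx hy
  have h2 := h.summable.sum_add_tsum_nat_add a
  rw [h.tsum_eq] at h2
  simp only [tail, Set.projIcc_of_mem _ hx, Set.projIcc_of_mem _ hy, add_comm a]
  linarith

@[simp] theorem tail_zero (G : Multigraphon) (x y : ℝ) : G.tail x y 0 = 1 := by simp [tail]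

theorem tail_le_one (G : Multigraphon) (x y : ℝ) (a : ℕ) : G.tail x y a ≤ 1 :=
  sub_le_self _ (Finset.sum_nonneg fun _ _ => G.nonneg _ _ _)

theorem tail_nonneg (G : Multigraphon) (x y : ℝ) (a : ℕ) : 0 ≤ G.tail x y a :=
  sub_nonneg.2 (sum_le_hasSum _ (fun _ _ => G.nonneg _ _ _)
    (G.hasSum_one (Subtype.coe_prop _) (Subtype.coe_prop _)))

theorem tail_antitone (G : Multigraphon) (x y : ℝ) : Antitone (G.tail x y) := fun _ _ h =>
  sub_le_sub_left (Finset.sum_le_sum_of_subset_of_nonneg (Finset.range_mono h)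
    fun _ _ _ => G.nonneg _ _ _) _

theorem tendsto_tail (G : Multigraphon) (x y : ℝ) :
    Tendsto (G.tail x y) atTop (nhds 0) := by
  have h := (G.hasSum_one (Set.projIcc (0:ℝ) 1 zero_le_one x).2
    (Set.projIcc (0:ℝ) 1 zero_le_one y).2).tendsto_sum_nat.const_sub 1
  rwa [sub_self] at h

theorem measurable_tail (G : Multigraphon) {α : Type*} [MeasurableSpace α] {u v : α → ℝ}
    (hu : Measurable u) (hv : Measurable v) (a : ℕ) :
    Measurable fun t => G.tail (u t) (v t) a := by
  have hp : Measurable fun x : ℝ => (Set.projIcc (0:ℝ) 1 zero_le_one x : ℝ) :=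
    (continuous_subtype_val.comp continuous_projIcc).measurable
  refine measurable_const.sub (Finset.measurable_sum _ fun l _ => ?_)
  exact (G.measurable l).comp ((hp.comp hu).prodMk (hp.comp hv))

/-- The integrand of `tleW`, with the tail sums extended from `[0,1]²` to `ℝ²`. -/
noncomputable def density (G : Multigraphon) {k : ℕ} (A : Matrix (Fin k) (Fin k) ℕ)
    (x : Fin k → ℝ) : ℝ :=
  ∏ p ∈ Finset.univ.filter (fun p : Fin k × Fin k => p.1 ≤ p.2),
    G.tail (x p.1) (x p.2) (A p.1 p.2)

theorem density_eq_prod_prod (G : Multigraphon) {k : ℕ} (A : Matrix (Fin k) (Fin k) ℕ)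
    (x : Fin k → ℝ) :
    G.density A x = ∏ i, ∏ j, if i ≤ j then G.tail (x i) (x j) (A i j) else 1 := by
  rw [density, Finset.prod_filter, Fintype.prod_prod_type]

theorem measurable_density (G : Multigraphon) {k : ℕ} (A : Matrix (Fin k) (Fin k) ℕ) :
    Measurable (G.density A) :=
  Finset.measurable_prod _ fun _ _ =>
    G.measurable_tail (measurable_pi_apply _) (measurable_pi_apply _) _

theorem density_nonneg (G : Multigraphon) {k : ℕ} (A : Matrix (Fin k) (Fin k) ℕ)
    (x : Fin k → ℝ) : 0 ≤ G.density A x :=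
  Finset.prod_nonneg fun _ _ => G.tail_nonneg _ _ _

theorem density_le_one (G : Multigraphon) {k : ℕ} (A : Matrix (Fin k) (Fin k) ℕ)
    (x : Fin k → ℝ) : G.density A x ≤ 1 :=
  Finset.prod_le_one (fun _ _ => G.tail_nonneg _ _ _) fun _ _ => G.tail_le_one _ _ _

theorem density_le_tail (G : Multigraphon) {k : ℕ} (A : Matrix (Fin k) (Fin k) ℕ)
    (x : Fin k → ℝ) {i j : Fin k} (hij : i ≤ j) :
    G.density A x ≤ G.tail (x i) (x j) (A i j) := by
  have hm : (i, j) ∈ Finset.univ.filter (fun p : Fin k × Fin k => p.1 ≤ p.2) := by simpa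
  rw [density, ← Finset.mul_prod_erase _ _ hm]
  exact mul_le_of_le_one_right (G.tail_nonneg _ _ _)
    (Finset.prod_le_one (fun _ _ => G.tail_nonneg _ _ _) fun _ _ => G.tail_le_one _ _ _)

end Multigraphon

/-- Lebesgue measure on `[0,1]`. -/
noncomputable abbrev unitMeasure : Measure ℝ := volume.restrict (Set.Icc 0 1)

instance : IsProbabilityMeasure unitMeasure := ⟨by simp⟩

/-- Lebesgue measure on the cube `[0,1]^k`. -/
noncomputable abbrev cubeMeasure (k : ℕ) : Measure (Fin k → ℝ) := Measure.pi fun _ => unitMeasure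

theorem tleW_eq_integral_density {k : ℕ} (A : Matrix (Fin k) (Fin k) ℕ) (G : Multigraphon) :
    tleW A G = ∫ x, G.density A x ∂cubeMeasure k := by
  rw [tleW, cubeMeasure, ← Measure.restrict_pi_pi, ← volume_pi]
  refine setIntegral_congr_fun (MeasurableSet.univ_pi fun _ => measurableSet_Icc) fun x hx => ?_
  exact Finset.prod_congr rfl fun p _ => G.tsum_eq_tail (hx _ trivial) (hx _ trivial) _

theorem measurable_append (a b : ℕ) :
    Measurable fun p : (Fin a → ℝ) × (Fin b → ℝ) => Fin.append p.1 p.2 := by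
  refine measurable_pi_iff.2 fun i => ?_
  refine Fin.addCases (fun i => ?_) (fun i => ?_) i
  · simpa using! (measurable_pi_apply i).comp measurable_fst
  · simpa using! (measurable_pi_apply i).comp measurable_snd

theorem measurePreserving_append (a b : ℕ) :
    MeasurePreserving (fun p : (Fin a → ℝ) × (Fin b → ℝ) => Fin.append p.1 p.2)
      ((cubeMeasure a).prod (cubeMeasure b)) (cubeMeasure (a + b)) := by
  refine ⟨measurable_append a b, (Measure.pi_eq fun s hs => ?_).symm⟩
  rw [Measure.map_apply (measurable_append a b) (MeasurableSet.univ_pi hs)]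
  have : (fun p : (Fin a → ℝ) × (Fin b → ℝ) => Fin.append p.1 p.2) ⁻¹' Set.univ.pi s =
      (Set.univ.pi fun i => s (Fin.castAdd b i)) ×ˢ (Set.univ.pi fun i => s (Fin.natAdd a i)) := by
    ext p
    simp [Set.mem_pi, Fin.forall_fin_add]
  rw [this, Measure.prod_prod, Measure.pi_pi, Measure.pi_pi, Fin.prod_univ_add]

theorem integrable_of_mem_unitInterval {α : Type*} [MeasurableSpace α] {μ : Measure α}
    [IsFiniteMeasure μ] {f : α → ℝ} (hf : Measurable f) (h0 : ∀ x, 0 ≤ f x) (h1 : ∀ x, f x ≤ 1) :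
    Integrable f μ :=
  .of_bound hf.aestronglyMeasurable 1
    (.of_forall fun x => by rw [Real.norm_of_nonneg (h0 x)]; exact h1 x)

theorem integral_le_one {α : Type*} [MeasurableSpace α] {μ : Measure α}
    [IsProbabilityMeasure μ] {f : α → ℝ} (hf : Measurable f) (h0 : ∀ x, 0 ≤ f x)
    (h1 : ∀ x, f x ≤ 1) : ∫ x, f x ∂μ ≤ 1 := by
  simpa using integral_mono (integrable_of_mem_unitInterval (μ := μ) hf h0 h1)
    (integrable_const 1) h1

theorem integral_append {a b : ℕ} {f : (Fin (a + b) → ℝ) → ℝ} (hf : Measurable f)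
    (h0 : ∀ x, 0 ≤ f x) (h1 : ∀ x, f x ≤ 1) :
    ∫ x, f x ∂cubeMeasure (a + b) =
      ∫ x, ∫ y, f (Fin.append x y) ∂cubeMeasure b ∂cubeMeasure a := by
  have hm := hf.comp (measurable_append a b)
  rw [← (measurePreserving_append a b).map_eq,
    integral_map (measurable_append a b).aemeasurable hf.aestronglyMeasurable]
  exact integral_prod _ (integrable_of_mem_unitInterval hm (fun _ => h0 _) fun _ => h1 _)

namespace Multigraphon

theorem density_blockDiag_append (G : Multigraphon) {k₁ k₂ : ℕ}
    (A₁ : Matrix (Fin k₁) (Fin k₁) ℕ) (A₂ : Matrix (Fin k₂) (Fin k₂) ℕ)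
    (x : Fin k₁ → ℝ) (y : Fin k₂ → ℝ) :
    G.density (blockDiag A₁ A₂) (Fin.append x y) = G.density A₁ x * G.density A₂ y := by
  have h (i j : Fin k₁) : Fin.castAdd k₂ i ≤ Fin.castAdd k₂ j ↔ i ≤ j := Iff.rfl
  simp [density_eq_prod_prod, Fin.prod_univ_add, blockDiag, Finset.prod_mul_distrib, h]

/-- The factors of the density of a `k`-labeled multigraph that involve an unlabeled vertex. -/
noncomputable def unlabeledDensity (G : Multigraphon) {k n : ℕ}
    (A : Matrix (Fin (k + n)) (Fin (k + n)) ℕ) (x : Fin k → ℝ) (y : Fin n → ℝ) : ℝ :=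
  (∏ i, ∏ j, G.tail (x i) (y j) (A (Fin.castAdd n i) (Fin.natAdd k j))) *
    G.density (A.submatrix (Fin.natAdd k) (Fin.natAdd k)) y

end Multigraphon

section glue

variable {k n₁ n₂ : ℕ} (A₁ : Matrix (Fin (k + n₁)) (Fin (k + n₁)) ℕ)
  (A₂ : Matrix (Fin (k + n₂)) (Fin (k + n₂)) ℕ)

theorem glue_labeled_labeled (i j : Fin k) :
    glue k n₁ n₂ A₁ A₂ (Fin.castAdd n₂ (Fin.castAdd n₁ i)) (Fin.castAdd n₂ (Fin.castAdd n₁ j)) =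
      max (A₁ (Fin.castAdd n₁ i) (Fin.castAdd n₁ j))
        (A₂ (Fin.castAdd n₂ i) (Fin.castAdd n₂ j)) := by
  simp [glue, matExt, glueIdx, Fin.castAdd, Fin.castLE, Nat.lt_add_right _ i.2,
    Nat.lt_add_right _ j.2]

theorem glue_labeled_left (i : Fin k) (j : Fin n₁) :
    glue k n₁ n₂ A₁ A₂ (Fin.castAdd n₂ (Fin.castAdd n₁ i)) (Fin.castAdd n₂ (Fin.natAdd k j)) =
      A₁ (Fin.castAdd n₁ i) (Fin.natAdd k j) := by
  simp [glue, matExt, glueIdx, Fin.castAdd, Fin.castLE, Fin.natAdd, Nat.lt_add_right _ i.2,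
    j.2.not_ge]

theorem glue_left_left (i j : Fin n₁) :
    glue k n₁ n₂ A₁ A₂ (Fin.castAdd n₂ (Fin.natAdd k i)) (Fin.castAdd n₂ (Fin.natAdd k j)) =
      A₁ (Fin.natAdd k i) (Fin.natAdd k j) := by
  simp [glue, matExt, glueIdx, Fin.castAdd, Fin.castLE, Fin.natAdd, i.2.not_ge]

theorem glue_labeled_right (i : Fin k) (j : Fin n₂) :
    glue k n₁ n₂ A₁ A₂ (Fin.castAdd n₂ (Fin.castAdd n₁ i)) (Fin.natAdd (k + n₁) j) =
      A₂ (Fin.castAdd n₂ i) (Fin.natAdd k j) := by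
  have h : k + n₁ + (j : ℕ) - n₁ = k + j := by omega
  have h' : ¬ k + n₁ + (j : ℕ) < k := by omega
  simp [glue, matExt, glueIdx, Fin.castAdd, Fin.castLE, Fin.natAdd, Nat.lt_add_right _ i.2, h, h']

theorem glue_left_right (i : Fin n₁) (j : Fin n₂) :
    glue k n₁ n₂ A₁ A₂ (Fin.castAdd n₂ (Fin.natAdd k i)) (Fin.natAdd (k + n₁) j) = 0 := by
  simp [glue, matExt, glueIdx, Fin.castAdd, Fin.castLE, Fin.natAdd, i.2.not_ge]

theorem glue_right_right (i j : Fin n₂) :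
    glue k n₁ n₂ A₁ A₂ (Fin.natAdd (k + n₁) i) (Fin.natAdd (k + n₁) j) =
      A₂ (Fin.natAdd k i) (Fin.natAdd k j) := by
  have h (j : Fin n₂) : k + n₁ + (j : ℕ) - n₁ = k + j := by omega
  have h' (j : Fin n₂) : ¬ k + n₁ + (j : ℕ) < k := by omega
  simp [glue, matExt, glueIdx, Fin.natAdd, h, h']

theorem Multigraphon.density_glue_append (G : Multigraphon) (x : Fin k → ℝ) (y : Fin n₁ → ℝ)
    (z : Fin n₂ → ℝ) :
    G.density (glue k n₁ n₂ A₁ A₂) (Fin.append (Fin.append x y) z) =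
      G.density (Matrix.of fun i j => max (A₁ (Fin.castAdd n₁ i) (Fin.castAdd n₁ j))
        (A₂ (Fin.castAdd n₂ i) (Fin.castAdd n₂ j))) x *
      G.unlabeledDensity A₁ x y * G.unlabeledDensity A₂ x z := by
  have h1 (i : Fin k) (j : Fin n₂) :
      (Fin.castAdd n₂ (Fin.castAdd n₁ i)) ≤ Fin.natAdd (k + n₁) j := by
    simp [Fin.le_def]; omega
  have h2 (i : Fin n₁) (j : Fin n₂) :
      (Fin.castAdd n₂ (Fin.natAdd k i)) ≤ Fin.natAdd (k + n₁) j := by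
    simp [Fin.le_def]; omega
  have h3 (i : Fin k) (j : Fin n₂) :
      ¬ Fin.natAdd (k + n₁) j ≤ (Fin.castAdd n₂ (Fin.castAdd n₁ i)) := by
    simp [Fin.le_def]; omega
  have h4 (i : Fin n₁) (j : Fin n₂) :
      ¬ Fin.natAdd (k + n₁) j ≤ (Fin.castAdd n₂ (Fin.natAdd k i)) := by
    simp [Fin.le_def]; omega
  have h5 (i : Fin k) (j : Fin n₁) :
      (Fin.castAdd n₂ (Fin.castAdd n₁ i)) ≤ Fin.castAdd n₂ (Fin.natAdd k j) := by
    simp [Fin.le_def]; omega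
  have h6 (i : Fin k) (j : Fin n₁) :
      ¬ Fin.castAdd n₂ (Fin.natAdd k j) ≤ (Fin.castAdd n₂ (Fin.castAdd n₁ i)) := by
    simp [Fin.le_def]; omega
  simp only [unlabeledDensity, density_eq_prod_prod, Fin.prod_univ_add, glue_labeled_labeled,
    glue_labeled_left, glue_left_left, glue_labeled_right, glue_left_right, glue_right_right,
    h1, h2, h3, h4, h5, h6, if_true, if_false, Finset.prod_mul_distrib, Fin.append_left,
    Fin.append_right, tail_zero, Finset.prod_const_one, Matrix.of_apply, Matrix.submatrix_apply,
    mul_one]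
  simp only [Fin.le_def, Fin.val_castAdd, Fin.val_natAdd, add_le_add_iff_left]

end glue

namespace Multigraphon

theorem measurable_unlabeledDensity (G : Multigraphon) {k n : ℕ}
    (A : Matrix (Fin (k + n)) (Fin (k + n)) ℕ) :
    Measurable fun p : (Fin k → ℝ) × (Fin n → ℝ) => G.unlabeledDensity A p.1 p.2 := by
  refine .mul (Finset.measurable_prod _ fun i _ => Finset.measurable_prod _ fun j _ => ?_)
    ((G.measurable_density _).comp measurable_snd)
  exact G.measurable_tail ((measurable_pi_apply i).comp measurable_fst)
    ((measurable_pi_apply j).comp measurable_snd) _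

theorem unlabeledDensity_nonneg (G : Multigraphon) {k n : ℕ}
    (A : Matrix (Fin (k + n)) (Fin (k + n)) ℕ) (x : Fin k → ℝ) (y : Fin n → ℝ) :
    0 ≤ G.unlabeledDensity A x y :=
  mul_nonneg (Finset.prod_nonneg fun _ _ => Finset.prod_nonneg fun _ _ => G.tail_nonneg _ _ _)
    (G.density_nonneg _ _)

theorem unlabeledDensity_le_one (G : Multigraphon) {k n : ℕ}
    (A : Matrix (Fin (k + n)) (Fin (k + n)) ℕ) (x : Fin k → ℝ) (y : Fin n → ℝ) :
    G.unlabeledDensity A x y ≤ 1 :=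
  mul_le_one₀ (Finset.prod_le_one
      (fun _ _ => Finset.prod_nonneg fun _ _ => G.tail_nonneg _ _ _)
      fun _ _ => Finset.prod_le_one (fun _ _ => G.tail_nonneg _ _ _) fun _ _ => G.tail_le_one _ _ _)
    (G.density_nonneg _ _) (G.density_le_one _ _)

/-- The conditional density of the unlabeled part of a `k`-labeled multigraph. -/
noncomputable def unlabeledIntegral (G : Multigraphon) {k n : ℕ}
    (A : Matrix (Fin (k + n)) (Fin (k + n)) ℕ) (x : Fin k → ℝ) : ℝ :=
  ∫ y, G.unlabeledDensity A x y ∂cubeMeasure n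

theorem measurable_unlabeledIntegral (G : Multigraphon) {k n : ℕ}
    (A : Matrix (Fin (k + n)) (Fin (k + n)) ℕ) : Measurable (G.unlabeledIntegral A) :=
  (G.measurable_unlabeledDensity A).stronglyMeasurable.integral_prod_right.measurable

theorem unlabeledIntegral_nonneg (G : Multigraphon) {k n : ℕ}
    (A : Matrix (Fin (k + n)) (Fin (k + n)) ℕ) (x : Fin k → ℝ) : 0 ≤ G.unlabeledIntegral A x :=
  integral_nonneg fun _ => G.unlabeledDensity_nonneg _ _ _

theorem unlabeledIntegral_le_one (G : Multigraphon) {k n : ℕ}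
    (A : Matrix (Fin (k + n)) (Fin (k + n)) ℕ) (x : Fin k → ℝ) : G.unlabeledIntegral A x ≤ 1 := by
  have hm : Measurable (G.unlabeledDensity A x) :=
    Measurable.of_uncurry_left (G.measurable_unlabeledDensity A)
  exact integral_le_one hm (G.unlabeledDensity_nonneg A x) (G.unlabeledDensity_le_one A x)

end Multigraphon

theorem tleW_glue (G : Multigraphon) {k n₁ n₂ : ℕ} (A₁ : Matrix (Fin (k + n₁)) (Fin (k + n₁)) ℕ)
    (A₂ : Matrix (Fin (k + n₂)) (Fin (k + n₂)) ℕ) :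
    tleW (glue k n₁ n₂ A₁ A₂) G =
      ∫ x, G.density (Matrix.of fun i j => max (A₁ (Fin.castAdd n₁ i) (Fin.castAdd n₁ j))
        (A₂ (Fin.castAdd n₂ i) (Fin.castAdd n₂ j))) x *
        (G.unlabeledIntegral A₁ x * G.unlabeledIntegral A₂ x) ∂cubeMeasure k := by
  have hm : Measurable (Function.uncurry fun (x : Fin (k + n₁) → ℝ) (y : Fin n₂ → ℝ) =>
      G.density (glue k n₁ n₂ A₁ A₂) (Fin.append x y)) :=
    (G.measurable_density _).comp (measurable_append (k + n₁) n₂)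
  rw [tleW_eq_integral_density, integral_append (G.measurable_density _) (G.density_nonneg _)
    (G.density_le_one _), integral_append]
  · simp only [G.density_glue_append, integral_const_mul, integral_mul_const,
      Multigraphon.unlabeledIntegral, mul_assoc]
  · exact hm.stronglyMeasurable.integral_prod_right.measurable
  · exact fun _ => integral_nonneg fun _ => G.density_nonneg _ _
  · intro x
    have hx : Measurable fun y => G.density (glue k n₁ n₂ A₁ A₂) (Fin.append x y) :=
      hm.of_uncurry_left
    exact integral_le_one hx (fun _ => G.density_nonneg _ _) fun _ => G.density_le_one _ _

theorem eq_add_sum_range_ite {s : ℕ → ℝ} {a M : ℕ} (h : a ≤ M) :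
    s a = s M + ∑ c ∈ Finset.range M, if a ≤ c then s c - s (c + 1) else 0 := by
  induction M, h using Nat.le_induction with
  | base => simp +contextual [Finset.sum_ite, Finset.filter_eq_empty_iff.2]
  | succ M h ih => rw [Finset.sum_range_succ, if_pos h]; linarith

theorem posSemidef_antitone_max {ι : Type*} [Fintype ι] {s : ℕ → ℝ} (hs : Antitone s)
    (h0 : ∀ a, 0 ≤ s a) (b : ι → ℕ) :
    (Matrix.of fun l m => s (max (b l) (b m))).PosSemidef := by
  set M := Finset.univ.sup b
  have hM (l : ι) : b l ≤ M := Finset.le_sup (Finset.mem_univ l)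
  have key : (Matrix.of fun l m => s (max (b l) (b m))) =
      s M • Matrix.vecMulVec (fun _ : ι => (1:ℝ)) (star fun _ => 1) +
      ∑ c ∈ Finset.range M, (s c - s (c + 1)) •
        Matrix.vecMulVec (fun l : ι => if b l ≤ c then (1:ℝ) else 0)
          (star fun l => if b l ≤ c then 1 else 0) := by
    ext l m
    rw [Matrix.of_apply, eq_add_sum_range_ite (s := s) (max_le (hM l) (hM m))]
    simp [Matrix.sum_apply, Matrix.vecMulVec_apply, ← ite_and, and_comm]
  rw [key]
  exact ((Matrix.posSemidef_vecMulVec_self_star _).smul (h0 M)).add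
    (Matrix.posSemidef_sum _ fun c _ => (Matrix.posSemidef_vecMulVec_self_star _).smul
      (sub_nonneg.2 (hs c.le_succ)))

theorem Matrix.posSemidef_prod {ι κ : Type*} [Fintype ι] (t : Finset κ)
    (K : κ → Matrix ι ι ℝ) (hK : ∀ p ∈ t, (K p).PosSemidef) :
    (Matrix.of fun l m => ∏ p ∈ t, K p l m).PosSemidef := by
  induction t using Finset.induction_on with
  | empty =>
    convert Matrix.posSemidef_vecMulVec_self_star (fun _ : ι => (1:ℝ))
    ext; simp [Matrix.vecMulVec_apply]
  | insert p t hp ih =>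
    have h : (K p ⊙ Matrix.of fun l m => ∏ q ∈ t, K q l m).PosSemidef :=
      (hK p (Finset.mem_insert_self p t)).hadamard
        (ih fun q hq => hK q (Finset.mem_insert_of_mem hq))
    convert h
    ext; simp [Finset.prod_insert hp]

theorem Matrix.posSemidef_integral {ι α : Type*} [Fintype ι] [MeasurableSpace α] {μ : Measure α}
    {K : α → Matrix ι ι ℝ} (hi : ∀ l m, Integrable (fun x => K x l m) μ)
    (hK : ∀ x, (K x).PosSemidef) : (Matrix.of fun l m => ∫ x, K x l m ∂μ).PosSemidef := by
  rw [Matrix.posSemidef_iff_dotProduct_mulVec]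
  refine ⟨?_, fun c => ?_⟩
  · ext l m
    simpa using integral_congr_ae (.of_forall fun x => by simpa using (hK x).1.apply l m)
  · have h (x) := (hK x).dotProduct_mulVec_nonneg c
    have : star c ⬝ᵥ (Matrix.of fun l m => ∫ x, K x l m ∂μ) *ᵥ c =
        ∫ x, star c ⬝ᵥ K x *ᵥ c ∂μ := by
      simp only [dotProduct, Matrix.mulVec, Matrix.of_apply]
      rw [integral_finsetSum _ fun l _ =>
        (integrable_finsetSum _ fun m _ => (hi l m).mul_const _).const_mul _]
      refine Finset.sum_congr rfl fun l _ => ?_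
      rw [integral_const_mul, integral_finsetSum _ fun m _ => (hi l m).mul_const _]
      simp only [integral_mul_const]
    rw [this]
    exact integral_nonneg h

theorem tleW_zero (G : Multigraphon) (k : ℕ) :
    tleW (0 : Matrix (Fin k) (Fin k) ℕ) G = 1 := by
  simp [tleW_eq_integral_density, Multigraphon.density]

theorem tleW_blockDiag (G : Multigraphon) {k₁ k₂ : ℕ} (A₁ : Matrix (Fin k₁) (Fin k₁) ℕ)
    (A₂ : Matrix (Fin k₂) (Fin k₂) ℕ) :
    tleW (blockDiag A₁ A₂) G = tleW A₁ G * tleW A₂ G := by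
  simp only [tleW_eq_integral_density]
  rw [integral_append (G.measurable_density _) (G.density_nonneg _) (G.density_le_one _)]
  simp only [G.density_blockDiag_append, integral_const_mul, integral_mul_const]

theorem tleW_nonneg {k : ℕ} (A : Matrix (Fin k) (Fin k) ℕ) (G : Multigraphon) : 0 ≤ tleW A G := by
  rw [tleW_eq_integral_density]
  exact integral_nonneg (G.density_nonneg A)

theorem tleW_le_integral_tail (G : Multigraphon) {k : ℕ} (A : Matrix (Fin k) (Fin k) ℕ)
    {i j : Fin k} (hij : i ≤ j) :
    tleW A G ≤ ∫ x, G.tail (x i) (x j) (A i j) ∂cubeMeasure k := by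
  rw [tleW_eq_integral_density]
  exact integral_mono
    (integrable_of_mem_unitInterval (G.measurable_density A) (G.density_nonneg A)
      (G.density_le_one A))
    (integrable_of_mem_unitInterval (G.measurable_tail (measurable_pi_apply i)
      (measurable_pi_apply j) _) (fun _ => G.tail_nonneg _ _ _) fun _ => G.tail_le_one _ _ _)
    fun x => G.density_le_tail A x hij

theorem tendsto_integral_tail (G : Multigraphon) {k : ℕ} (i j : Fin k) :
    Tendsto (fun a => ∫ x, G.tail (x i) (x j) a ∂cubeMeasure k) atTop (nhds 0) := by
  have := tendsto_integral_of_dominated_convergence (μ := cubeMeasure k)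
    (F := fun a x => G.tail (x i) (x j) a) (f := fun _ => 0) (fun _ => 1)
    (fun a => (G.measurable_tail (measurable_pi_apply i)
      (measurable_pi_apply j) a).aestronglyMeasurable) (integrable_const 1)
    (fun a => .of_forall fun x => by
      rw [Real.norm_of_nonneg (G.tail_nonneg _ _ _)]; exact G.tail_le_one _ _ _)
    (.of_forall fun x => G.tendsto_tail _ _)
  simpa using this

theorem exists_le_entry_of_mul_lt_numEdges {k M : ℕ} {A : Matrix (Fin k) (Fin k) ℕ}
    (hA : IsAdj A) (h : k * (k * M) < numEdges A) : ∃ i j, i ≤ j ∧ M ≤ A i j := by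
  by_contra! hc
  have hle (i j : Fin k) : A i j ≤ M := by
    rcases le_total i j with hij | hij
    · exact (hc i j hij).le
    · rw [hA.1]; exact (hc j i hij).le
  have : ∑ i, ∑ j, A i j ≤ k * (k * M) := by
    simpa using Finset.sum_le_sum fun i (_ : i ∈ Finset.univ) =>
      Finset.sum_le_sum fun j (_ : j ∈ Finset.univ) => hle i j
  exact absurd (h.trans_le (Nat.div_le_self _ 2)) this.not_gt

theorem tendsto_tleW_zero (G : Multigraphon) {k : ℕ} {A : ℕ → Matrix (Fin k) (Fin k) ℕ}
    (hA : ∀ m, IsAdj (A m)) (he : Tendsto (fun m => numEdges (A m)) atTop atTop) :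
    Tendsto (fun m => tleW (A m) G) atTop (nhds 0) := by
  refine tendsto_order.2 ⟨fun c hc => .of_forall fun m => hc.trans_le (tleW_nonneg _ _),
    fun ε hε => ?_⟩
  have h : ∀ᶠ a in atTop, ∀ i j : Fin k, ∫ x, G.tail (x i) (x j) a ∂cubeMeasure k < ε :=
    eventually_all.2 fun i => eventually_all.2 fun j =>
      (tendsto_integral_tail G i j).eventually_lt_const hε
  obtain ⟨M, hM⟩ := eventually_atTop.1 h
  filter_upwards [he.eventually_gt_atTop (k * (k * M))] with m hm
  obtain ⟨i, j, hij, hle⟩ := exists_le_entry_of_mul_lt_numEdges (hA m) hm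
  exact (tleW_le_integral_tail G (A m) hij).trans_lt (hM _ hle i j)

theorem posSemidef_tleW_glue (G : Multigraphon) {ι : Type*} [Fintype ι] {k : ℕ} (n : ι → ℕ)
    (F : ∀ l, Matrix (Fin (k + n l)) (Fin (k + n l)) ℕ) :
    (Matrix.of fun l m => tleW (glue k (n l) (n m) (F l) (F m)) G).PosSemidef := by
  simp only [tleW_glue]
  refine Matrix.posSemidef_integral (K := fun x => Matrix.of fun l m => _) (fun l m => ?_)
    fun x => ?_
  · refine integrable_of_mem_unitInterval ((G.measurable_density _).mul
      ((G.measurable_unlabeledIntegral _).mul (G.measurable_unlabeledIntegral _)))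
      (fun x => ?_) fun x => ?_
    · exact mul_nonneg (G.density_nonneg _ _)
        (mul_nonneg (G.unlabeledIntegral_nonneg _ _) (G.unlabeledIntegral_nonneg _ _))
    · exact mul_le_one₀ (G.density_le_one _ _)
        (mul_nonneg (G.unlabeledIntegral_nonneg _ _) (G.unlabeledIntegral_nonneg _ _))
        (mul_le_one₀ (G.unlabeledIntegral_le_one _ _) (G.unlabeledIntegral_nonneg _ _)
          (G.unlabeledIntegral_le_one _ _))
  · exact (Matrix.posSemidef_prod _ _ fun p _ => posSemidef_antitone_max
      (G.tail_antitone (x p.1) (x p.2)) (G.tail_nonneg _ _)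
      fun l => F l (Fin.castAdd _ p.1) (Fin.castAdd _ p.2)).hadamard
      (Matrix.posSemidef_vecMulVec_self_star fun l => G.unlabeledIntegral (F l) x)

/-- For every multigraphon `W`, the multigraph parameter `A ↦ t_≤(A,W)` is
normalized, multiplicative, non-defective and reflection positive. -/
theorem tleW_normalized_multiplicative_nondefective_reflectionPositive (G : Multigraphon) :
    -- normalized
    (tleW (0 : Matrix (Fin 1) (Fin 1) ℕ) G = 1) ∧
    -- multiplicative
    (∀ (k₁ k₂ : ℕ) (A₁ : Matrix (Fin k₁) (Fin k₁) ℕ) (A₂ : Matrix (Fin k₂) (Fin k₂) ℕ),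
      IsAdj A₁ → IsAdj A₂ → tleW (blockDiag A₁ A₂) G = tleW A₁ G * tleW A₂ G) ∧
    -- non-defective
    (∀ (k : ℕ) (A : ℕ → Matrix (Fin k) (Fin k) ℕ), (∀ m, IsAdj (A m)) →
      Tendsto (fun m => numEdges (A m)) atTop atTop →
      Tendsto (fun m => tleW (A m) G) atTop (nhds 0)) ∧
    -- reflection positive
    (∀ (k N : ℕ) (nl : Fin N → ℕ)
      (F : ∀ l : Fin N, Matrix (Fin (k + nl l)) (Fin (k + nl l)) ℕ),
      (∀ l, IsAdj (F l)) →
      (Matrix.of fun l m : Fin N =>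
        tleW (glue k (nl l) (nl m) (F l) (F m)) G).PosSemidef) := by
  exact ⟨tleW_zero G 1, fun _ _ A₁ A₂ _ _ => tleW_blockDiag G A₁ A₂,
    fun _ _ hA he => tendsto_tleW_zero G hA he, fun _ _ n F _ => posSemidef_tleW_glue G n F⟩
end

section
/- If a multigraph parameter f is normalized, multiplicative, non-defective, and its Möbius transform satisfies f†(A) ≥ 0 for every k and A ∈ A_k, then there exists a sequence of multigraphs, i.e. adjacency matrices B_n ∈ A_{m_n} with m_n → ∞, such that t_≤(A,B_n) → f(A) as n → ∞ for every k ∈ ℕ and every A ∈ A_k. -/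
open scoped Classical BigOperators
open Filter

/-- `E ∈ E_k`: symmetric, off-diagonal entries in `{0,1}`, diagonal entries in `{0,2}`. -/
def IsEdgeM {k : ℕ} (E : Matrix (Fin k) (Fin k) ℕ) : Prop :=
  (∀ i j, E i j = E j i) ∧ (∀ i j, i ≠ j → E i j ≤ 1) ∧ ∀ i, E i i = 0 ∨ E i i = 2

/-- The (finite) set `E_k` of edge matrices, realized as a `Finset`. -/
noncomputable def edgeFinset (k : ℕ) : Finset (Matrix (Fin k) (Fin k) ℕ) :=
  Finset.image (fun (E : Fin k → Fin k → Fin 3) => (Matrix.of fun i j => (E i j : ℕ)))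
    (Finset.univ.filter fun E => IsEdgeM (Matrix.of fun i j => (E i j : ℕ)))

/-- Möbius transform `f†(A) = ∑_{E ∈ E_k} (−1)^{e(E)} f(A+E)`. -/
noncomputable def mobius {k : ℕ} (f : Matrix (Fin k) (Fin k) ℕ → ℝ)
    (A : Matrix (Fin k) (Fin k) ℕ) : ℝ :=
  ∑ E ∈ edgeFinset k, (-1 : ℝ) ^ numEdges E * f (A + E)

/-- Homomorphism density
`t_≤(A,B) = n^{−k} ∑_{φ:[k]→[n]} 1[∀ i,j : A(i,j) ≤ B(φ(i),φ(j))]`. -/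
noncomputable def homDensity {k n : ℕ} (A : Matrix (Fin k) (Fin k) ℕ)
    (B : Matrix (Fin n) (Fin n) ℕ) : ℝ :=
  (1 / (n : ℝ) ^ k) *
    ∑ φ : Fin k → Fin n, (if ∀ i j, A i j ≤ B (φ i) (φ j) then (1 : ℝ) else 0)

section BoxSum

variable {ι κ : Type*} [Fintype ι] [DecidableEq ι]

/-- A sum of product weights over a box, written as a sum over the values of the point at which `g`
is evaluated. -/
theorem sum_piFinset_prod_mul_comp (g : (ι → ℕ) → ℝ) (t : Finset κ) (c : ι → κ → ℝ)
    (h : ι → κ → ℕ) (M : ℕ) (hM : ∀ i, ∀ p ∈ t, h i p ≤ M) :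
    ∑ p ∈ Fintype.piFinset (fun _ : ι => t), (∏ i, c i (p i)) * g (fun i => h i (p i)) =
      ∑ y ∈ Fintype.piFinset (fun _ : ι => Finset.range (M + 1)),
        g y * ∏ i, ∑ p ∈ t, c i p * (if y i = h i p then 1 else 0) := by
  simp_rw [Finset.prod_univ_sum, Finset.mul_sum]
  rw [Finset.sum_comm]
  refine Finset.sum_congr rfl fun p hp => ?_
  rw [Fintype.mem_piFinset] at hp
  rw [Finset.sum_eq_single (fun i => h i (p i))]
  · simp [mul_comm]
  · intro y _ hy
    obtain ⟨i, hi⟩ := Function.ne_iff.mp hy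
    rw [Finset.prod_eq_zero (Finset.mem_univ i) (by simp [hi]), mul_zero]
  · intro hn
    refine absurd ?_ hn
    simpa [Fintype.mem_piFinset, Nat.lt_succ_iff] using fun i => hM i _ (hp i)

theorem sum_Ico_sum_sign_mul_indicator (a M y : ℕ) (ha : a ≤ M) :
    ∑ x ∈ Finset.Ico a M, ∑ s : Fin 2, (-1 : ℝ) ^ (s : ℕ) * (if y = x + s then 1 else 0) =
      ∑ s : Fin 2, (-1 : ℝ) ^ (s : ℕ) * (if y = if s = 0 then a else M then 1 else 0) := by
  induction M, ha using Nat.le_induction with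
  | base => simp
  | succ M hM ih =>
    rw [Finset.sum_Ico_succ_top hM, ih]
    simp only [Fin.sum_univ_two, Fin.val_zero, Fin.val_one, pow_zero, pow_one, one_mul, if_true,
      one_ne_zero, if_false, add_zero]
    ring

/-- Summing the iterated differences of `g` over a box telescopes to an alternating sum over its
corners. -/
theorem sum_box_alternating (g : (ι → ℕ) → ℝ) (a : ι → ℕ) (M : ℕ) (ha : ∀ i, a i ≤ M) :
    ∑ x ∈ Fintype.piFinset (fun i => Finset.Ico (a i) M), ∑ s : ι → Fin 2,
        (∏ i, (-1 : ℝ) ^ (s i : ℕ)) * g (fun i => x i + s i) =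
      ∑ s : ι → Fin 2, (∏ i, (-1 : ℝ) ^ (s i : ℕ)) * g (fun i => if s i = 0 then a i else M) := by
  have key := fun (h : ι → Fin 2 → ℕ) (hM : ∀ i, ∀ p ∈ (Finset.univ : Finset (Fin 2)), h i p ≤ M) =>
    sum_piFinset_prod_mul_comp g Finset.univ 
      (fun _ (s : Fin 2) => (-1 : ℝ) ^ (s : ℕ)) h M hM
  simp only [Fintype.piFinset_univ] at key
  rw [key (fun i s => if s = 0 then a i else M) (fun i p _ => by split_ifs <;> simp [ha i])]
  rw [Finset.sum_congr rfl fun x hx => key (fun i s => x i + s) fun i p _ => by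
    have := Finset.mem_Ico.1 (Fintype.mem_piFinset.1 hx i)
    have := p.isLt
    omega]
  rw [Finset.sum_comm]
  refine Finset.sum_congr rfl fun y _ => ?_
  rw [← Finset.mul_sum]
  congr 1
  rw [← Finset.prod_univ_sum (fun i => Finset.Ico (a i) M)
    (fun i x => ∑ s : Fin 2, (-1 : ℝ) ^ (s : ℕ) * (if y i = x + s then 1 else 0))]
  exact Finset.prod_congr rfl fun i _ => sum_Ico_sum_sign_mul_indicator _ _ _ (ha i)

end BoxSum

section Coordinates

variable {n : ℕ}

/-- The adjacency matrix of the multigraph with edge multiplicities `x`. -/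
def toAdj (x : Sym2 (Fin n) → ℕ) : Matrix (Fin n) (Fin n) ℕ :=
  Matrix.of fun i j => if i = j then 2 * x s(i, j) else x s(i, j)

theorem isAdj_toAdj (x : Sym2 (Fin n) → ℕ) : IsAdj (toAdj x) :=
  ⟨fun i j => by simp [toAdj, eq_comm (a := i), Sym2.eq_swap], fun i => by simp [toAdj]⟩

theorem exists_toAdj_eq {A : Matrix (Fin n) (Fin n) ℕ} (hA : IsAdj A) : ∃ x, toAdj x = A := by
  refine ⟨Sym2.lift ⟨fun i j => if i = j then A i j / 2 else A i j, fun i j => ?_⟩, ?_⟩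
  · simp only [hA.1 i j, eq_comm (a := i)]
  · ext i j
    by_cases h : i = j
    · subst h
      simpa [toAdj] using Nat.two_mul_div_two_of_even (hA.2 i)
    · simp [toAdj, h]

theorem toAdj_le_iff (a x : Sym2 (Fin n) → ℕ) :
    (∀ i j, toAdj a i j ≤ toAdj x i j) ↔ ∀ e, a e ≤ x e := by
  simp only [Sym2.forall]
  refine forall_congr' fun i => forall_congr' fun j => ?_
  by_cases h : i = j <;> simp [toAdj, h]

theorem toAdj_injective : Function.Injective (toAdj (n := n)) := fun a b h =>
  funext fun e => le_antisymm ((toAdj_le_iff a b).1 (fun _ _ => h ▸ le_rfl) e)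
    ((toAdj_le_iff b a).1 (fun _ _ => h ▸ le_rfl) e)

theorem toAdj_add (x y : Sym2 (Fin n) → ℕ) : toAdj (fun e => x e + y e) = toAdj x + toAdj y := by
  ext i j
  by_cases h : i = j <;> simp [toAdj, h, mul_add]

theorem numEdges_toAdj (x : Sym2 (Fin n) → ℕ) : numEdges (toAdj x) = ∑ e, x e := by
  have h : ∑ i, ∑ j, toAdj x i j = 2 * ∑ e, x e := by
    rw [← Fintype.sum_prod_type' (fun i j => toAdj x i j),
      ← Finset.sum_fiberwise (g := fun p : Fin n × Fin n => s(p.1, p.2)),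
      Finset.mul_sum]
    refine Finset.sum_congr rfl fun e _ => ?_
    induction e using Sym2.ind with
    | _ a b =>
      by_cases hab : a = b
      · subst hab
        rw [Finset.sum_eq_single (a, a)] <;> simp [toAdj]
      · have : (Finset.univ.filter fun p : Fin n × Fin n => s(p.1, p.2) = s(a, b)) =
            {(a, b), (b, a)} := by
          ext ⟨c, d⟩; simp
        rw [this, Finset.sum_pair (by simp [hab])]
        simp [toAdj, hab, Ne.symm hab, Sym2.eq_swap (a := b), two_mul]
  rw [numEdges, h, Nat.mul_div_cancel_left _ two_pos]

theorem mem_edgeFinset {E : Matrix (Fin n) (Fin n) ℕ} : E ∈ edgeFinset n ↔ IsEdgeM E := by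
  simp only [edgeFinset, Finset.mem_image, Finset.mem_filter, Finset.mem_univ, true_and]
  constructor
  · rintro ⟨E, h, rfl⟩
    exact h
  · intro h
    have hlt : ∀ i j, E i j < 3 := fun i j => by
      by_cases hij : i = j
      · subst hij
        rcases h.2.2 i with h | h <;> omega
      · have := h.2.1 i j hij
        omega
    exact ⟨fun i j => ⟨E i j, hlt i j⟩, h, rfl⟩

theorem isEdgeM_toAdj (s : Sym2 (Fin n) → Fin 2) : IsEdgeM (toAdj fun e => (s e : ℕ)) := by
  refine ⟨(isAdj_toAdj _).1, fun i j h => ?_, fun i => ?_⟩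
  · simp only [toAdj, Matrix.of_apply, h, if_false]
    omega
  · simp only [toAdj, Matrix.of_apply, if_true]
    omega

theorem exists_toAdj_eq_of_isEdgeM {E : Matrix (Fin n) (Fin n) ℕ} (hE : IsEdgeM E) :
    ∃ s : Sym2 (Fin n) → Fin 2, toAdj (fun e => (s e : ℕ)) = E := by
  have hA : IsAdj E := ⟨hE.1, fun i => by rcases hE.2.2 i with h | h <;> simp [h]⟩
  obtain ⟨x, rfl⟩ := exists_toAdj_eq hA
  refine ⟨fun e => ⟨x e, ?_⟩, rfl⟩
  induction e using Sym2.ind with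
  | _ i j =>
    by_cases h : i = j
    · subst h
      have := hE.2.2 i
      simp only [toAdj, Matrix.of_apply, if_true] at this
      omega
    · have := hE.2.1 i j h
      simp only [toAdj, Matrix.of_apply, h, if_false] at this
      omega

theorem mobius_toAdj (f : Matrix (Fin n) (Fin n) ℕ → ℝ) (x : Sym2 (Fin n) → ℕ) :
    mobius f (toAdj x) = ∑ s : Sym2 (Fin n) → Fin 2,
      (∏ e, (-1 : ℝ) ^ (s e : ℕ)) * f (toAdj fun e => x e + s e) := by
  symm
  refine Finset.sum_bij (fun s _ => toAdj fun e => (s e : ℕ))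
    (fun s _ => mem_edgeFinset.2 (isEdgeM_toAdj s)) (fun s _ t _ h => ?_) (fun E hE => ?_)
    (fun s _ => ?_)
  · exact funext fun e => Fin.ext (congrFun (toAdj_injective h) e)
  · obtain ⟨s, hs⟩ := exists_toAdj_eq_of_isEdgeM (mem_edgeFinset.1 hE)
    exact ⟨s, Finset.mem_univ _, hs⟩
  · rw [numEdges_toAdj, Finset.prod_pow_eq_pow_sum, toAdj_add]

end Coordinates

section BoxMean

variable {n : ℕ}

/-- The sum of `G`, weighted by the Möbius transform of `F`, over all multigraphs with edge
multiplicities below `M`. -/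
noncomputable def boxMean (F : Matrix (Fin n) (Fin n) ℕ → ℝ) (M : ℕ)
    (G : Matrix (Fin n) (Fin n) ℕ → ℝ) : ℝ :=
  ∑ x ∈ Fintype.piFinset (fun _ : Sym2 (Fin n) => Finset.range M),
    mobius F (toAdj x) * G (toAdj x)

theorem boxMean_congr {F : Matrix (Fin n) (Fin n) ℕ → ℝ} (M : ℕ)
    {G H : Matrix (Fin n) (Fin n) ℕ → ℝ} (h : ∀ B, G B = H B) :
    boxMean F M G = boxMean F M H :=
  congrArg _ (funext h)

theorem boxMean_mono {F : Matrix (Fin n) (Fin n) ℕ → ℝ}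
    (hF : ∀ A, IsAdj A → 0 ≤ mobius F A) (M : ℕ) {G H : Matrix (Fin n) (Fin n) ℕ → ℝ}
    (h : ∀ B, IsAdj B → G B ≤ H B) : boxMean F M G ≤ boxMean F M H :=
  Finset.sum_le_sum fun x _ =>
    mul_le_mul_of_nonneg_left (h _ (isAdj_toAdj x)) (hF _ (isAdj_toAdj x))

theorem boxMean_const_mul (F : Matrix (Fin n) (Fin n) ℕ → ℝ) (M : ℕ) (c : ℝ)
    (G : Matrix (Fin n) (Fin n) ℕ → ℝ) : boxMean F M (fun B => c * G B) = c * boxMean F M G := by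
  simp only [boxMean, Finset.mul_sum, mul_left_comm c]

theorem boxMean_sum {α : Type*} (F : Matrix (Fin n) (Fin n) ℕ → ℝ) (M : ℕ) (s : Finset α)
    (G : α → Matrix (Fin n) (Fin n) ℕ → ℝ) :
    boxMean F M (fun B => ∑ i ∈ s, G i B) = ∑ i ∈ s, boxMean F M (G i) := by
  simp only [boxMean, Finset.mul_sum]
  exact Finset.sum_comm

theorem boxMean_add (F : Matrix (Fin n) (Fin n) ℕ → ℝ) (M : ℕ)
    (G H : Matrix (Fin n) (Fin n) ℕ → ℝ) :
    boxMean F M (fun B => G B + H B) = boxMean F M G + boxMean F M H := by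
  simp only [boxMean, mul_add, Finset.sum_add_distrib]

/-- Möbius inversion: the total weight of the multigraphs above `A` is `F A` in the limit. -/
theorem tendsto_boxMean_indicator {F : Matrix (Fin n) (Fin n) ℕ → ℝ}
    (hF : ∀ A : ℕ → Matrix (Fin n) (Fin n) ℕ, (∀ m, IsAdj (A m)) →
      Tendsto (fun m => numEdges (A m)) atTop atTop → Tendsto (fun m => F (A m)) atTop (nhds 0))
    {A : Matrix (Fin n) (Fin n) ℕ} (hA : IsAdj A) :
    Tendsto (fun M => boxMean F M fun B => if ∀ i j, A i j ≤ B i j then 1 else 0) atTop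
      (nhds (F A)) := by
  obtain ⟨a, rfl⟩ := exists_toAdj_eq hA
  have hbox : ∀ M ≥ ∑ e, a e,
      ∑ s : Sym2 (Fin n) → Fin 2, (∏ e, (-1 : ℝ) ^ (s e : ℕ)) *
          F (toAdj fun e => if s e = 0 then a e else M) =
        boxMean F M fun B => if ∀ i j, toAdj a i j ≤ B i j then 1 else 0 := by
    intro M hM
    have ha : ∀ e, a e ≤ M := fun e =>
      (Finset.single_le_sum (fun _ _ => Nat.zero_le _) (Finset.mem_univ e)).trans hM
    rw [← sum_box_alternating (fun x => F (toAdj x)) a M ha, boxMean]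
    simp only [toAdj_le_iff, mul_ite, mul_one, mul_zero, ← mobius_toAdj, ← Finset.sum_filter]
    refine Finset.sum_congr (Finset.ext fun x => ?_) fun _ _ => rfl
    simp only [Fintype.mem_piFinset, Finset.mem_filter, Finset.mem_Ico, Finset.mem_range,
      ← forall_and, and_comm]
  refine Tendsto.congr' (eventually_atTop.2 ⟨_, hbox⟩) ?_
  have hlim : ∀ s : Sym2 (Fin n) → Fin 2,
      Tendsto (fun M : ℕ => (∏ e, (-1 : ℝ) ^ (s e : ℕ)) *
          F (toAdj fun e => if s e = 0 then a e else M)) atTop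
        (nhds (if s = 0 then F (toAdj a) else 0)) := by
    intro s
    by_cases hs : s = 0
    · simp [hs]
    · rw [if_neg hs, ← mul_zero (∏ e, (-1 : ℝ) ^ (s e : ℕ))]
      refine (hF _ (fun M => isAdj_toAdj _) ?_).const_mul _
      obtain ⟨e, he⟩ := Function.ne_iff.mp hs
      refine tendsto_atTop_mono (fun M => ?_) tendsto_id
      rw [numEdges_toAdj]
      refine le_trans ?_ (Finset.single_le_sum (fun _ _ => Nat.zero_le _) (Finset.mem_univ e))
      exact (if_neg he).ge
  simpa using tendsto_finsetSum Finset.univ fun s _ => hlim s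

end BoxMean

section Density

theorem blockDiag_castAdd_castAdd {k m : ℕ} (A : Matrix (Fin k) (Fin k) ℕ)
    (B : Matrix (Fin m) (Fin m) ℕ) (i j : Fin k) :
    blockDiag A B (Fin.castAdd m i) (Fin.castAdd m j) = A i j := by
  simp [blockDiag]

theorem blockDiag_natAdd_natAdd {k m : ℕ} (A : Matrix (Fin k) (Fin k) ℕ)
    (B : Matrix (Fin m) (Fin m) ℕ) (i j : Fin m) :
    blockDiag A B (Fin.natAdd k i) (Fin.natAdd k j) = B i j := by
  simp [blockDiag]

theorem blockDiag_castAdd_natAdd {k m : ℕ} (A : Matrix (Fin k) (Fin k) ℕ)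
    (B : Matrix (Fin m) (Fin m) ℕ) (i : Fin k) (j : Fin m) :
    blockDiag A B (Fin.castAdd m i) (Fin.natAdd k j) = 0 := by
  simp [blockDiag]

theorem blockDiag_natAdd_castAdd {k m : ℕ} (A : Matrix (Fin k) (Fin k) ℕ)
    (B : Matrix (Fin m) (Fin m) ℕ) (i : Fin m) (j : Fin k) :
    blockDiag A B (Fin.natAdd k i) (Fin.castAdd m j) = 0 := by
  simp [blockDiag]

theorem forall_blockDiag_le_iff {k m : ℕ} (A : Matrix (Fin k) (Fin k) ℕ)
    (B : Matrix (Fin m) (Fin m) ℕ) (C : Fin (k + m) → Fin (k + m) → ℕ) :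
    (∀ i j, blockDiag A B i j ≤ C i j) ↔
      (∀ i j, A i j ≤ C (Fin.castAdd m i) (Fin.castAdd m j)) ∧
        ∀ i j, B i j ≤ C (Fin.natAdd k i) (Fin.natAdd k j) := by
  simp only [Fin.forall_fin_add, blockDiag_castAdd_castAdd, blockDiag_natAdd_natAdd,
    blockDiag_castAdd_natAdd, blockDiag_natAdd_castAdd, Nat.zero_le, implies_true, and_true,
    true_and]

theorem isAdj_zero {k : ℕ} : IsAdj (0 : Matrix (Fin k) (Fin k) ℕ) := by
  simp [IsAdj]

theorem IsAdj.blockDiag {k m : ℕ} {A : Matrix (Fin k) (Fin k) ℕ} {B : Matrix (Fin m) (Fin m) ℕ}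
    (hA : IsAdj A) (hB : IsAdj B) : IsAdj (blockDiag A B) := by
  constructor
  · simp only [Fin.forall_fin_add, blockDiag_castAdd_castAdd, blockDiag_natAdd_natAdd,
      blockDiag_castAdd_natAdd, blockDiag_natAdd_castAdd, implies_true, and_true, true_and]
    exact ⟨hA.1, hB.1⟩
  · simpa only [Fin.forall_fin_add, blockDiag_castAdd_castAdd, blockDiag_natAdd_natAdd] using
      And.intro hA.2 hB.2

theorem homDensity_fin_zero {n : ℕ} (A : Matrix (Fin 0) (Fin 0) ℕ) (B : Matrix (Fin n) (Fin n) ℕ) :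
    homDensity A B = 1 := by
  simp [homDensity]

theorem homDensity_blockDiag {k m n : ℕ} (A : Matrix (Fin k) (Fin k) ℕ)
    (C : Matrix (Fin m) (Fin m) ℕ) (B : Matrix (Fin n) (Fin n) ℕ) :
    homDensity (blockDiag A C) B = homDensity A B * homDensity C B := by
  simp only [homDensity]
  rw [mul_mul_mul_comm, Finset.sum_mul_sum, ← Fintype.sum_prod_type', pow_add, one_div_mul_one_div]
  congr 1
  rw [← (Fin.appendEquiv k m).sum_comp]
  refine Finset.sum_congr rfl fun φ _ => ?_
  simp only [forall_blockDiag_le_iff A C fun i j =>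
    B (Fin.appendEquiv k m φ i) (Fin.appendEquiv k m φ j)]
  simp [← ite_and, and_comm]

theorem sum_indicator_injective (k n : ℕ) :
    ∑ φ : Fin k → Fin n, (if Function.Injective φ then (1 : ℝ) else 0) = n.descFactorial k := by
  rw [Finset.sum_boole, ← Fintype.card_subtype,
    Fintype.card_congr (Equiv.subtypeInjectiveEquivEmbedding (Fin k) (Fin n)),
    Fintype.card_embedding_eq, Fintype.card_fin, Fintype.card_fin]

theorem tendsto_descFactorial_div_pow (k : ℕ) :
    Tendsto (fun n : ℕ => (n.descFactorial k : ℝ) / (n : ℝ) ^ k) atTop (nhds 1) :=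
  (Asymptotics.isEquivalent_iff_tendsto_one
    ((eventually_ne_atTop 0).mono fun n hn => by positivity)).1 (isEquivalent_descFactorial k)

end Density

section Parameter

variable {f : ∀ k : ℕ, Matrix (Fin k) (Fin k) ℕ → ℝ}

theorem apply_zero_eq_one (hnorm : f 1 0 = 1)
    (hmult : ∀ (k₁ k₂ : ℕ) (A₁ : Matrix (Fin k₁) (Fin k₁) ℕ) (A₂ : Matrix (Fin k₂) (Fin k₂) ℕ),
      IsAdj A₁ → IsAdj A₂ → f (k₁ + k₂) (blockDiag A₁ A₂) = f k₁ A₁ * f k₂ A₂) (k : ℕ) :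
    f k 0 = 1 := by
  have hzero : ∀ m l : ℕ, f (m + l) 0 = f m 0 * f l 0 := fun m l => by
    rw [← hmult m l 0 0 isAdj_zero isAdj_zero]
    simp [blockDiag]
  induction k with
  | zero => simpa [hnorm] using (hzero 1 0).symm
  | succ k ih => rw [hzero, ih, hnorm, one_mul]

/-- Placing `A` on the image of an injection of its vertices, and no edges elsewhere, does not
change the value of the parameter. -/
theorem exists_image_of_injective
    (hinv : ∀ (k : ℕ) (σ : Equiv.Perm (Fin k)) (A : Matrix (Fin k) (Fin k) ℕ), IsAdj A →
      f k (Matrix.of fun i j => A (σ i) (σ j)) = f k A)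
    (hnorm : f 1 0 = 1)
    (hmult : ∀ (k₁ k₂ : ℕ) (A₁ : Matrix (Fin k₁) (Fin k₁) ℕ) (A₂ : Matrix (Fin k₂) (Fin k₂) ℕ),
      IsAdj A₁ → IsAdj A₂ → f (k₁ + k₂) (blockDiag A₁ A₂) = f k₁ A₁ * f k₂ A₂)
    {k n : ℕ} {A : Matrix (Fin k) (Fin k) ℕ} (hA : IsAdj A) {φ : Fin k → Fin n}
    (hφ : Function.Injective φ) :
    ∃ C : Matrix (Fin n) (Fin n) ℕ, IsAdj C ∧ f n C = f k A ∧
      ∀ B : Matrix (Fin n) (Fin n) ℕ,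
        (∀ u v, C u v ≤ B u v) ↔ ∀ i j, A i j ≤ B (φ i) (φ j) := by
  obtain ⟨m, rfl⟩ := Nat.exists_eq_add_of_le (by simpa using Fintype.card_le_of_injective φ hφ)
  obtain ⟨σ, hσ⟩ := Equiv.Perm.exists_extending_pair _ _ (Fin.castAdd_injective k m) hφ
  have hD : IsAdj (blockDiag A (0 : Matrix (Fin m) (Fin m) ℕ)) := hA.blockDiag isAdj_zero
  refine ⟨Matrix.of fun u v => blockDiag A 0 (σ⁻¹ u) (σ⁻¹ v), ⟨fun u v => hD.1 _ _, fun u => hD.2 _⟩,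
    ?_, fun B => ?_⟩
  · rw [hinv _ _ _ hD, hmult _ _ _ _ hA isAdj_zero, apply_zero_eq_one hnorm hmult, mul_one]
  · rw [← σ.forall_congr_right]
    simp only [← σ.forall_congr_right (q := fun v => Matrix.of _ _ v ≤ _)]
    simp [forall_blockDiag_le_iff A 0 fun u v => B (σ u) (σ v), hσ]

theorem boxMean_homDensity {k n : ℕ} (F : Matrix (Fin n) (Fin n) ℕ → ℝ) (M : ℕ)
    (A : Matrix (Fin k) (Fin k) ℕ) :
    boxMean F M (homDensity A) = 1 / (n : ℝ) ^ k * ∑ φ : Fin k → Fin n,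
      boxMean F M fun B => if ∀ i j, A i j ≤ B (φ i) (φ j) then 1 else 0 := by
  rw [← boxMean_sum, ← boxMean_const_mul]
  rfl

theorem tendsto_boxMean_homDensity
    (hinv : ∀ (k : ℕ) (σ : Equiv.Perm (Fin k)) (A : Matrix (Fin k) (Fin k) ℕ), IsAdj A →
      f k (Matrix.of fun i j => A (σ i) (σ j)) = f k A)
    (hnorm : f 1 0 = 1)
    (hmult : ∀ (k₁ k₂ : ℕ) (A₁ : Matrix (Fin k₁) (Fin k₁) ℕ) (A₂ : Matrix (Fin k₂) (Fin k₂) ℕ),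
      IsAdj A₁ → IsAdj A₂ → f (k₁ + k₂) (blockDiag A₁ A₂) = f k₁ A₁ * f k₂ A₂)
    (hnd : ∀ (k : ℕ) (A : ℕ → Matrix (Fin k) (Fin k) ℕ), (∀ m, IsAdj (A m)) →
      Tendsto (fun m => numEdges (A m)) atTop atTop →
      Tendsto (fun m => f k (A m)) atTop (nhds 0))
    (hmob : ∀ (k : ℕ) (A : Matrix (Fin k) (Fin k) ℕ), IsAdj A → 0 ≤ mobius (f k) A)
    {k : ℕ} {A : Matrix (Fin k) (Fin k) ℕ} (hA : IsAdj A) :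
    Tendsto (fun p : ℕ × ℕ => boxMean (f p.1) p.2 (homDensity A)) (atTop.curry atTop)
      (nhds (f k A)) := by
  rw [Metric.tendsto_nhds]
  intro ε hε
  rw [eventually_curry_iff]
  set C := 2 + |f k A| with hC
  have hcount : Tendsto (fun n : ℕ => C * (1 - (n.descFactorial k : ℝ) / (n : ℝ) ^ k)) atTop
      (nhds 0) := by
    simpa using ((tendsto_descFactorial_div_pow k).const_sub 1).const_mul C
  filter_upwards [hcount.eventually (gt_mem_nhds (half_pos hε)), eventually_gt_atTop 0]
    with n hn hpos
  have hone : Tendsto (fun M => boxMean (f n) M fun _ => 1) atTop (nhds 1) := by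
    simpa [apply_zero_eq_one hnorm hmult] using
      tendsto_boxMean_indicator (hnd n) (isAdj_zero (k := n))
  have hterm : ∀ φ : Fin k → Fin n, ∀ᶠ M in atTop,
      |(boxMean (f n) M fun B => if ∀ i j, A i j ≤ B (φ i) (φ j) then 1 else 0) - f k A| ≤
        (ε / 2 + C) - C * (if Function.Injective φ then 1 else 0) := by
    intro φ
    by_cases hφ : Function.Injective φ
    · obtain ⟨D, hD, hfD, hDB⟩ := exists_image_of_injective hinv hnorm hmult hA hφ
      have := tendsto_boxMean_indicator (hnd n) hD
      simp only [hDB, hfD] at this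
      filter_upwards [Metric.tendsto_nhds.1 this _ (half_pos hε)] with M hM
      rw [Real.dist_eq] at hM
      simpa [hφ] using hM.le
    · filter_upwards [hone.eventually (gt_mem_nhds one_lt_two)] with M hM
      have h0 : 0 ≤ boxMean (f n) M fun B => if ∀ i j, A i j ≤ B (φ i) (φ j) then 1 else 0 :=
        Finset.sum_nonneg fun x _ => mul_nonneg (hmob _ _ (isAdj_toAdj x)) (by positivity)
      have h1 : (boxMean (f n) M fun B => if ∀ i j, A i j ≤ B (φ i) (φ j) then 1 else 0) ≤
          boxMean (f n) M fun _ => 1 :=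
        boxMean_mono (hmob n) M fun B _ => by split_ifs <;> norm_num
      rw [if_neg hφ, mul_zero, sub_zero, abs_le]
      constructor <;> linarith [neg_abs_le (f k A), le_abs_self (f k A)]
  filter_upwards [eventually_all.2 hterm] with M hM
  have hnk : (0 : ℝ) < (n : ℝ) ^ k := by positivity
  have havg : boxMean (f n) M (homDensity A) - f k A = (∑ φ : Fin k → Fin n,
      ((boxMean (f n) M fun B => if ∀ i j, A i j ≤ B (φ i) (φ j) then 1 else 0) - f k A)) /
        (n : ℝ) ^ k := by
    rw [boxMean_homDensity, Finset.sum_sub_distrib]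
    simp
    field_simp
  rw [Real.dist_eq, havg, abs_div, abs_of_pos hnk, div_lt_iff₀ hnk]
  refine (Finset.abs_sum_le_sum_abs _ _).trans_lt
    ((Finset.sum_le_sum fun φ _ => hM φ).trans_lt ?_)
  rw [Finset.sum_sub_distrib, ← Finset.mul_sum, sum_indicator_injective]
  simp only [Finset.sum_const, Finset.card_univ, Fintype.card_fun, Fintype.card_fin, nsmul_eq_mul,
    Nat.cast_pow]
  have := mul_lt_mul_of_pos_right hn hnk
  rw [mul_assoc, sub_mul, div_mul_cancel₀ _ hnk.ne'] at this
  linarith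

theorem tendsto_boxMean_sq_sub
    (hinv : ∀ (k : ℕ) (σ : Equiv.Perm (Fin k)) (A : Matrix (Fin k) (Fin k) ℕ), IsAdj A →
      f k (Matrix.of fun i j => A (σ i) (σ j)) = f k A)
    (hnorm : f 1 0 = 1)
    (hmult : ∀ (k₁ k₂ : ℕ) (A₁ : Matrix (Fin k₁) (Fin k₁) ℕ) (A₂ : Matrix (Fin k₂) (Fin k₂) ℕ),
      IsAdj A₁ → IsAdj A₂ → f (k₁ + k₂) (blockDiag A₁ A₂) = f k₁ A₁ * f k₂ A₂)
    (hnd : ∀ (k : ℕ) (A : ℕ → Matrix (Fin k) (Fin k) ℕ), (∀ m, IsAdj (A m)) →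
      Tendsto (fun m => numEdges (A m)) atTop atTop →
      Tendsto (fun m => f k (A m)) atTop (nhds 0))
    (hmob : ∀ (k : ℕ) (A : Matrix (Fin k) (Fin k) ℕ), IsAdj A → 0 ≤ mobius (f k) A)
    {k : ℕ} {A : Matrix (Fin k) (Fin k) ℕ} (hA : IsAdj A) :
    Tendsto (fun p : ℕ × ℕ => boxMean (f p.1) p.2 fun B => (homDensity A B - f k A) ^ 2)
      (atTop.curry atTop) (nhds 0) := by
  have hT := fun {k : ℕ} {A : Matrix (Fin k) (Fin k) ℕ} (hA : IsAdj A) =>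
    tendsto_boxMean_homDensity hinv hnorm hmult hnd hmob hA
  have h := ((hT (hA.blockDiag hA)).add ((hT hA).const_mul (-2 * f k A))).add
    ((hT (isAdj_zero (k := 0))).const_mul (f k A ^ 2))
  rw [hmult _ _ _ _ hA hA, apply_zero_eq_one hnorm hmult,
    show f k A * f k A + -2 * f k A * f k A + f k A ^ 2 * 1 = 0 by ring] at h
  refine h.congr fun p => ?_
  rw [← boxMean_const_mul, ← boxMean_const_mul, ← boxMean_add, ← boxMean_add]
  refine boxMean_congr _ fun B => ?_
  rw [homDensity_blockDiag, homDensity_fin_zero]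
  ring

/-- Second moment method: finitely many densities can be approximated by a single multigraph with
arbitrarily many vertices. -/
theorem exists_homDensity_approx
    (hinv : ∀ (k : ℕ) (σ : Equiv.Perm (Fin k)) (A : Matrix (Fin k) (Fin k) ℕ), IsAdj A →
      f k (Matrix.of fun i j => A (σ i) (σ j)) = f k A)
    (hnorm : f 1 0 = 1)
    (hmult : ∀ (k₁ k₂ : ℕ) (A₁ : Matrix (Fin k₁) (Fin k₁) ℕ) (A₂ : Matrix (Fin k₂) (Fin k₂) ℕ),
      IsAdj A₁ → IsAdj A₂ → f (k₁ + k₂) (blockDiag A₁ A₂) = f k₁ A₁ * f k₂ A₂)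
    (hnd : ∀ (k : ℕ) (A : ℕ → Matrix (Fin k) (Fin k) ℕ), (∀ m, IsAdj (A m)) →
      Tendsto (fun m => numEdges (A m)) atTop atTop →
      Tendsto (fun m => f k (A m)) atTop (nhds 0))
    (hmob : ∀ (k : ℕ) (A : Matrix (Fin k) (Fin k) ℕ), IsAdj A → 0 ≤ mobius (f k) A)
    (S : Finset (Σ k : ℕ, Matrix (Fin k) (Fin k) ℕ)) (hS : ∀ A ∈ S, IsAdj A.2)
    {ε : ℝ} (hε : 0 < ε) (N : ℕ) :
    ∃ n ≥ N, ∃ B : Matrix (Fin n) (Fin n) ℕ, IsAdj B ∧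
      ∀ A ∈ S, |homDensity A.2 B - f A.1 A.2| < ε := by
  have hsum : Tendsto (fun p : ℕ × ℕ => boxMean (f p.1) p.2 fun B =>
      ∑ A ∈ S, (homDensity A.2 B - f A.1 A.2) ^ 2 + -ε ^ 2 * homDensity (0 : Matrix (Fin 0) _ ℕ) B)
      (atTop.curry atTop) (nhds (-ε ^ 2)) := by
    simp only [boxMean_add, boxMean_sum, boxMean_const_mul]
    simpa [apply_zero_eq_one hnorm hmult] using
      (tendsto_finsetSum S fun A hA =>
        tendsto_boxMean_sq_sub hinv hnorm hmult hnd hmob (hS A hA)).add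
      ((tendsto_boxMean_homDensity hinv hnorm hmult hnd hmob (isAdj_zero (k := 0))).const_mul
        (-ε ^ 2))
  have hev := eventually_curry_iff.1
    (hsum.eventually (gt_mem_nhds (show -ε ^ 2 < 0 by linarith [pow_pos hε 2])))
  obtain ⟨n, hn, hnN⟩ := (hev.and (eventually_ge_atTop N)).exists
  obtain ⟨M, hM⟩ := hn.exists
  obtain ⟨x, -, hx⟩ := Finset.exists_lt_of_sum_lt (hM.trans_eq Finset.sum_const_zero.symm)
  refine ⟨n, hnN, toAdj x, isAdj_toAdj x, fun A hA => abs_lt_of_sq_lt_sq ?_ hε.le⟩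
  have hlt := neg_of_mul_neg_right hx (hmob n _ (isAdj_toAdj x))
  have hle := Finset.single_le_sum (f := fun A : Σ k : ℕ, Matrix (Fin k) (Fin k) ℕ =>
    (homDensity A.2 (toAdj x) - f A.1 A.2) ^ 2) (fun _ _ => sq_nonneg _) hA
  simp only [homDensity_fin_zero] at hlt
  linarith

end Parameter

/-- A normalized, multiplicative, non-defective multigraph parameter with nonnegative
Möbius transform is the limit of homomorphism densities of a sequence of multigraphs. -/
theorem exists_convergent_multigraph_sequence
    (f : ∀ k : ℕ, Matrix (Fin k) (Fin k) ℕ → ℝ)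
    -- `f` is a multigraph parameter: invariance under relabeling
    (hinv : ∀ (k : ℕ) (σ : Equiv.Perm (Fin k)) (A : Matrix (Fin k) (Fin k) ℕ), IsAdj A →
      f k (Matrix.of fun i j => A (σ i) (σ j)) = f k A)
    -- normalized
    (hnorm : f 1 0 = 1)
    -- multiplicative
    (hmult : ∀ (k₁ k₂ : ℕ) (A₁ : Matrix (Fin k₁) (Fin k₁) ℕ) (A₂ : Matrix (Fin k₂) (Fin k₂) ℕ),
      IsAdj A₁ → IsAdj A₂ → f (k₁ + k₂) (blockDiag A₁ A₂) = f k₁ A₁ * f k₂ A₂)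
    -- non-defective
    (hnd : ∀ (k : ℕ) (A : ℕ → Matrix (Fin k) (Fin k) ℕ), (∀ m, IsAdj (A m)) →
      Tendsto (fun m => numEdges (A m)) atTop atTop →
      Tendsto (fun m => f k (A m)) atTop (nhds 0))
    -- nonnegative Möbius transform
    (hmob : ∀ (k : ℕ) (A : Matrix (Fin k) (Fin k) ℕ), IsAdj A → 0 ≤ mobius (f k) A) :
    ∃ (m : ℕ → ℕ) (B : ∀ n : ℕ, Matrix (Fin (m n)) (Fin (m n)) ℕ),
      (∀ n, IsAdj (B n)) ∧ Tendsto m atTop atTop ∧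
      ∀ (k : ℕ) (A : Matrix (Fin k) (Fin k) ℕ), IsAdj A →
        Tendsto (fun n => homDensity A (B n)) atTop (nhds (f k A)) := by
  have : ∀ k : ℕ, Countable (Matrix (Fin k) (Fin k) ℕ) := fun k =>
    inferInstanceAs (Countable (Fin k → Fin k → ℕ))
  obtain ⟨e, he⟩ := exists_surjective_nat (Σ k : ℕ, Matrix (Fin k) (Fin k) ℕ)
  have happrox : ∀ N : ℕ, ∃ n ≥ N, ∃ B : Matrix (Fin n) (Fin n) ℕ, IsAdj B ∧
      ∀ i ≤ N, IsAdj (e i).2 → |homDensity (e i).2 B - f (e i).1 (e i).2| < 1 / ((N : ℝ) + 1) := by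
    intro N
    obtain ⟨n, hn, B, hB, h⟩ := exists_homDensity_approx hinv hnorm hmult hnd hmob
      (((Finset.range (N + 1)).image e).filter fun A => IsAdj A.2)
      (fun A hA => (Finset.mem_filter.1 hA).2) (Nat.one_div_pos_of_nat (α := ℝ) (n := N)) N
    exact ⟨n, hn, B, hB, fun i hi hA => h _ (Finset.mem_filter.2
      ⟨Finset.mem_image_of_mem e (Finset.mem_range.2 (Nat.lt_succ_of_le hi)), hA⟩)⟩
  choose m hm B hB h using happrox
  refine ⟨m, B, hB, tendsto_atTop_mono hm tendsto_id, fun k A hA => ?_⟩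
  obtain ⟨i, hi⟩ := he ⟨k, A⟩
  refine tendsto_iff_norm_sub_tendsto_zero.2 (squeeze_zero' (Eventually.of_forall fun _ =>
    norm_nonneg _) ?_ tendsto_one_div_add_atTop_nhds_zero_nat)
  filter_upwards [eventually_ge_atTop i] with N hN
  have := h N i hN
  rw [hi] at this
  exact (this hA).le
end

section
/- Let (X(i,j))_{i,j ∈ ℤ∖{0}} be an ℕ₀-valued symmetric array (X(i,j) = X(j,i) a.s., X(i,i) even a.s.) whose joint distribution is invariant under every finitely supported permutation of the index set ℤ∖{0}. For each n ∈ ℕ let Y_n be the random variable (X(n,j))_{j<0} with values in ℕ₀^{ℤ₋}. Then the family (Y_n)_{n∈ℕ} is conditionally independent given the σ-algebra generated by (X(i,j))_{i,j<0}. -/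
open MeasureTheory ProbabilityTheory
open scoped BigOperators

/-- Nonzero integers: the index set `ℤ ∖ {0}`. -/
abbrev NZ : Type := {z : ℤ // z ≠ 0}
/-- Negative integers `ℤ₋`. -/
abbrev NegZ : Type := {z : ℤ // z < 0}
/-- Positive integers (the copy of `ℕ = {1,2,…}` inside `ℤ ∖ {0}`). -/
abbrev PosZ : Type := {z : ℤ // 0 < z}

def negToNZ (z : NegZ) : NZ := ⟨z.1, z.2.ne⟩
def posToNZ (z : PosZ) : NZ := ⟨z.1, z.2.ne'⟩

/-- A family `(Y_v)_{v ∈ V}` of random variables is conditionally independent given a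
sub-σ-algebra `m'` if for every finite subfamily and all bounded measurable real
functions `g_v`, `E[∏ g_v(Y_v) | m'] = ∏ E[g_v(Y_v) | m']` almost surely. -/
def CondIndepFam {Ω : Type*} {V : Type*} {S : Type*}
    [MeasurableSpace S] (m' : MeasurableSpace Ω) {m0 : MeasurableSpace Ω}
    (Y : V → Ω → S) (P : Measure Ω) : Prop :=
  ∀ (s : Finset V) (g : V → S → ℝ), (∀ v, Measurable (g v)) →
    (∀ v, ∃ C, ∀ x, ‖g v x‖ ≤ C) →
    (P[fun ω => ∏ v ∈ s, g v (Y v ω)|m'])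
      =ᵐ[P] fun ω => ∏ v ∈ s, (P[fun ω' => g v (Y v ω')|m']) ω

/-- On a finite set, an injective self-map agrees with a finitely supported permutation. -/
theorem exists_perm_finite_support_eqOn {ι : Type*} {φ : ι → ι} (hφ : Function.Injective φ)
    (J : Finset ι) :
    ∃ τ : Equiv.Perm ι, {x | τ x ≠ x}.Finite ∧ ∀ j ∈ J, τ j = φ j := by
  classical
  let K : Finset ι := J ∪ J.image φ
  obtain ⟨σ, hσ⟩ := Equiv.Perm.exists_extending_pair (α := J) (β := {x // x ∈ K})
    (fun j => ⟨j, Finset.mem_union_left _ j.2⟩)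
    (fun j => ⟨φ j, Finset.mem_union_right _ (Finset.mem_image_of_mem φ j.2)⟩)
    (fun a b h => Subtype.ext (congrArg (fun x : {x // x ∈ K} => x.1) h))
    (fun a b h => Subtype.ext (hφ (congrArg (fun x : {x // x ∈ K} => x.1) h)))
  refine ⟨Equiv.Perm.ofSubtype σ, K.finite_toSet.subset fun x hx => ?_, fun j hj => ?_⟩
  · by_contra hxK
    exact hx (Equiv.Perm.ofSubtype_apply_of_not_mem σ hxK)
  · rw [Equiv.Perm.ofSubtype_apply_of_mem σ (Finset.mem_union_left _ hj), hσ ⟨j, hj⟩]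

/-- A jointly exchangeable array is invariant in law under injections of the index set. -/
theorem map_array_comp_injective_eq {Ω ι S : Type*} [MeasurableSpace Ω] [MeasurableSpace S]
    {P : Measure Ω} [IsFiniteMeasure P] {X : ι → ι → Ω → S} (hX : ∀ i j, Measurable (X i j))
    (hexch : ∀ τ : Equiv.Perm ι, {x | τ x ≠ x}.Finite →
      Measure.map (fun ω => fun p : ι × ι => X (τ p.1) (τ p.2) ω) P =
        Measure.map (fun ω => fun p : ι × ι => X p.1 p.2 ω) P)
    {φ : ι → ι} (hφ : Function.Injective φ) :
    Measure.map (fun ω => fun p : ι × ι => X (φ p.1) (φ p.2) ω) P =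
      Measure.map (fun ω => fun p : ι × ι => X p.1 p.2 ω) P := by
  classical
  have hmeas (ψ : ι → ι) : Measurable fun ω => fun p : ι × ι => X (ψ p.1) (ψ p.2) ω :=
    measurable_pi_lambda _ fun p => hX _ _
  have hrestrict (I : Finset (ι × ι)) : Measurable (I.restrict (π := fun _ => S)) :=
    Finset.measurable_restrict I
  refine IsProjectiveLimit.unique
    (P := fun I => (P.map fun ω => fun p : ι × ι => X p.1 p.2 ω).map I.restrict)
    (fun I => ?_) (fun I => rfl)
  obtain ⟨τ, hτ, hτφ⟩ :=
    exists_perm_finite_support_eqOn hφ (I.image Prod.fst ∪ I.image Prod.snd)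
  change _ = (P.map fun ω => fun p : ι × ι => X p.1 p.2 ω).map I.restrict
  rw [← hexch τ hτ, Measure.map_map (hrestrict I) (hmeas φ),
    Measure.map_map (hrestrict I) (hmeas τ)]
  congr 1
  ext ω p
  have h1 := hτφ p.1.1 (Finset.mem_union_left _ (Finset.mem_image_of_mem _ p.2))
  have h2 := hτφ p.1.2 (Finset.mem_union_right _ (Finset.mem_image_of_mem _ p.2))
  simp [h1, h2]

/-- If `(f, η)` and `(f, ζ)` have the same law and `ζ` is a function of `η`, then `η` predicts `f`
no better than `ζ` does. -/
theorem condExp_comap_ae_eq_of_map_eq {Ω E : Type*} [MeasurableSpace Ω] [MeasurableSpace E]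
    {P : Measure Ω} [IsProbabilityMeasure P] {f : Ω → ℝ} {η ζ : Ω → E} (hf : Measurable f)
    (hη : Measurable η) (hζ : Measurable ζ) {C : ℝ} (hC : ∀ᵐ ω ∂P, |f ω| ≤ C)
    (hle : MeasurableSpace.comap ζ inferInstance ≤ MeasurableSpace.comap η inferInstance)
    (h : P.map (fun ω => (f ω, η ω)) = P.map (fun ω => (f ω, ζ ω))) :
    P[f|MeasurableSpace.comap η inferInstance] =ᵐ[P]
      P[f|MeasurableSpace.comap ζ inferInstance] := by
  have hmη := hη.comap_le
  have hmζ := hζ.comap_le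
  have hfint : Integrable f P :=
    Integrable.of_bound hf.aestronglyMeasurable C (by simpa using hC)
  obtain ⟨u, hu, hau⟩ :=
    (stronglyMeasurable_condExp (m := MeasurableSpace.comap η inferInstance) (μ := P)
      (f := f)).exists_eq_measurable_comp
  set a := P[f|MeasurableSpace.comap η inferInstance] with ha
  set b := P[f|MeasurableSpace.comap ζ inferInstance] with hb
  have hid : IdentDistrib (fun ω => (f ω, η ω)) (fun ω => (f ω, ζ ω)) P P :=
    ⟨(hf.prodMk hη).aemeasurable, (hf.prodMk hζ).aemeasurable, h⟩
  have hid' : IdentDistrib η ζ P P := hid.comp measurable_snd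
  have haint : Integrable a P := integrable_condExp
  have huζ : Integrable (u ∘ ζ) P :=
    (hid'.comp hu.measurable).integrable_iff.1 (by rw [← hau]; exact haint)
  have hbu : u ∘ ζ =ᵐ[P] b := by
    refine ae_eq_condExp_of_forall_setIntegral_eq hmζ hfint (fun _ _ _ => huζ.integrableOn)
      ?_ (hu.comp_measurable (comap_measurable ζ)).aestronglyMeasurable
    rintro _ ⟨B, hB, rfl⟩ -
    have e1 : ∫ ω in ζ ⁻¹' B, (u ∘ ζ) ω ∂P = ∫ ω in η ⁻¹' B, (u ∘ η) ω ∂P := by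
      rw [← integral_indicator (hζ hB), ← integral_indicator (hη hB)]
      exact ((hid'.comp (hu.measurable.indicator hB)).integral_eq).symm
    have e2 : ∫ ω in ζ ⁻¹' B, f ω ∂P = ∫ ω in η ⁻¹' B, f ω ∂P := by
      rw [← integral_indicator (hζ hB), ← integral_indicator (hη hB)]
      exact ((hid.comp (u := (Prod.snd ⁻¹' B).indicator Prod.fst)
        (measurable_fst.indicator (measurable_snd hB))).integral_eq).symm
    rw [e1, e2, ← hau]
    exact setIntegral_condExp hmη hfint ⟨B, hB, rfl⟩
  have haC : ∀ᵐ ω ∂P, |a ω| ≤ C := ae_bdd_abs_condExp_of_ae_bdd_abs hC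
  have hbC : ∀ᵐ ω ∂P, |b ω| ≤ C := ae_bdd_abs_condExp_of_ae_bdd_abs hC
  have ham : AEStronglyMeasurable a P := haint.aestronglyMeasurable
  have hbm : AEStronglyMeasurable b P := integrable_condExp.aestronglyMeasurable
  have hbint : Integrable b P := integrable_condExp
  have haa : Integrable (a * a) P := haint.mul_bdd ham (by simpa using haC)
  have hba : Integrable (b * a) P := haint.bdd_mul hbm (by simpa using hbC)
  have hbb : Integrable (b * b) P := hbint.mul_bdd hbm (by simpa using hbC)
  have hsq : ∫ ω, (a * a) ω ∂P = ∫ ω, (b * b) ω ∂P := by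
    have e : ∫ ω, (b * b) ω ∂P = ∫ ω, (u ∘ ζ) ω * (u ∘ ζ) ω ∂P :=
      integral_congr_ae (by
        filter_upwards [hbu] with ω hω
        rw [Pi.mul_apply, hω])
    rw [e, hau]
    exact (hid'.comp (hu.measurable.mul hu.measurable)).integral_eq
  have hcross : ∫ ω, (b * a) ω ∂P = ∫ ω, (b * b) ω ∂P := by
    rw [← integral_condExp hmζ (f := b * a)]
    refine integral_congr_ae ?_
    filter_upwards [condExp_mul_of_stronglyMeasurable_left stronglyMeasurable_condExp hba haint,
      condExp_condExp_of_le (f := f) (μ := P) hle hmη] with ω h1 h2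
    rw [h1, Pi.mul_apply, Pi.mul_apply, h2]
  have hexpand : (fun ω => (a ω - b ω) ^ 2) = a * a - (b * a + b * a) + b * b := by
    ext ω; simp only [Pi.add_apply, Pi.sub_apply, Pi.mul_apply]; ring
  have hzero : ∫ ω, (a ω - b ω) ^ 2 ∂P = 0 := by
    rw [hexpand, integral_add' (haa.sub (hba.add hba)) hbb, integral_sub' haa (hba.add hba),
      integral_add' hba hba, hsq, hcross]
    ring
  have hint : Integrable (fun ω => (a ω - b ω) ^ 2) P := by
    rw [hexpand]
    exact (haa.sub (hba.add hba)).add hbb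
  filter_upwards [(integral_eq_zero_iff_of_nonneg (fun ω => sq_nonneg _) hint).1 hzero] with ω hω
  exact sub_eq_zero.1 (pow_eq_zero_iff two_ne_zero |>.1 hω)

/-- An injection of the index set fixing `n` and `-N, …, -1` and sending every index other than `n`
to a negative one. -/
theorem exists_injective_fixing_maps_to_neg (n : PosZ) (N : ℕ) :
    ∃ φ : NZ → NZ, Function.Injective φ ∧ φ (posToNZ n) = posToNZ n ∧
      (∀ j : NegZ, -(N : ℤ) ≤ j.1 → φ (negToNZ j) = negToNZ j) ∧
      ∀ i, i ≠ posToNZ n → (φ i).1 < 0 := by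
  obtain ⟨n, hn⟩ := n
  let ψ : ℤ → ℤ := fun z =>
    if z = n then z else if 0 < z then -2 * (N + z) else if -(N : ℤ) ≤ z then z else 2 * z - 1
  have hψ0 : ∀ z, z ≠ 0 → ψ z ≠ 0 := by
    intro z hz; simp only [ψ]; split_ifs <;> omega
  refine ⟨fun z => ⟨ψ z.1, hψ0 _ z.2⟩, ?_, ?_, ?_, ?_⟩
  · rintro ⟨x, hx⟩ ⟨y, hy⟩ h
    have h' : ψ x = ψ y := congrArg Subtype.val h
    simp only [ψ] at h'
    apply Subtype.ext
    change x = y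
    split_ifs at h' <;> omega
  · simp [posToNZ, ψ]
  · rintro ⟨j, hj⟩ hjN
    apply Subtype.ext
    change ψ j = j
    have : -(N : ℤ) ≤ j := hjN
    simp only [ψ]
    split_ifs <;> omega
  · rintro ⟨i, hi⟩ hin
    have : i ≠ n := fun h => hin (Subtype.ext h)
    change ψ i < 0
    simp only [ψ]
    split_ifs <;> omega

/-- `L¹`-limits of functions with a.e. equal conditional expectations inherit the equality. -/
theorem condExp_ae_eq_of_tendsto_eLpNorm {Ω : Type*} {m₁ m₂ m0 : MeasurableSpace Ω}
    {P : Measure Ω} {f : Ω → ℝ} {F : ℕ → Ω → ℝ} (hf : Integrable f P)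
    (hF : ∀ N, Integrable (F N) P)
    (hlim : Filter.Tendsto (fun N => eLpNorm (F N - f) 1 P) Filter.atTop (nhds 0))
    (heq : ∀ N, P[F N|m₁] =ᵐ[P] P[F N|m₂]) :
    P[f|m₁] =ᵐ[P] P[f|m₂] := by
  have hbound : ∀ N, eLpNorm (P[f|m₁] - P[f|m₂]) 1 P ≤
      eLpNorm (F N - f) 1 P + eLpNorm (F N - f) 1 P := by
    intro N
    have e : P[f|m₁] - P[f|m₂] =ᵐ[P] P[F N - f|m₂] - P[F N - f|m₁] := by
      filter_upwards [heq N, condExp_sub (hF N) hf m₁, condExp_sub (hF N) hf m₂] with ω h h1 h2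
      simp only [Pi.sub_apply] at h1 h2 ⊢
      rw [h1, h2, h]; ring
    rw [eLpNorm_congr_ae e]
    refine (eLpNorm_sub_le integrable_condExp.aestronglyMeasurable
      integrable_condExp.aestronglyMeasurable le_rfl).trans ?_
    exact add_le_add (eLpNorm_condExp_le_eLpNorm _ le_rfl) (eLpNorm_condExp_le_eLpNorm _ le_rfl)
  have h0 : eLpNorm (P[f|m₁] - P[f|m₂]) 1 P = 0 := by
    have hlim2 := hlim.add hlim
    rw [add_zero] at hlim2
    exact le_antisymm (ge_of_tendsto' hlim2 hbound) zero_le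
  have := (eLpNorm_eq_zero_iff (integrable_condExp.sub integrable_condExp).aestronglyMeasurable
    one_ne_zero).1 h0
  filter_upwards [this] with ω hω
  exact sub_eq_zero.1 hω

theorem negToNZ_ne_posToNZ (j : NegZ) (n : PosZ) : negToNZ j ≠ posToNZ n := fun h =>
  absurd (congrArg Subtype.val h) (j.2.trans n.2).ne

theorem comap_negative_le_comap_ne {Ω : Type*} (X : NZ → NZ → Ω → ℕ) (n : PosZ) :
    MeasurableSpace.comap
        (fun ω => fun p : NegZ × NegZ => X (negToNZ p.1) (negToNZ p.2) ω) inferInstance ≤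
      MeasurableSpace.comap
        (fun ω => fun p : {i // i ≠ posToNZ n} × {i // i ≠ posToNZ n} => X p.1 p.2 ω)
        inferInstance := by
  refine Measurable.comap_le (@measurable_pi_lambda _ _ _ (_) _ _ fun p => ?_)
  exact (measurable_pi_apply ((⟨negToNZ p.1, negToNZ_ne_posToNZ _ n⟩,
    ⟨negToNZ p.2, negToNZ_ne_posToNZ _ n⟩) :
      {i // i ≠ posToNZ n} × {i // i ≠ posToNZ n})).comp (comap_measurable
        (fun ω => fun p : {i // i ≠ posToNZ n} × {i // i ≠ posToNZ n} => X p.1 p.2 ω))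

/-- Given the negative part of an exchangeable array, the rest of the array away from index `n`
carries no further information on the row `(X(n,j))_{j<0}`. -/
theorem condExp_row_eq_condExp_negative_part
    {Ω : Type*} [m0 : MeasurableSpace Ω] (P : Measure Ω) [IsProbabilityMeasure P]
    (X : NZ → NZ → Ω → ℕ) (hXmeas : ∀ i j, Measurable (X i j))
    (hexch : ∀ τ : Equiv.Perm NZ, {x | τ x ≠ x}.Finite →
      Measure.map (fun ω => fun p : NZ × NZ => X (τ p.1) (τ p.2) ω) P =
        Measure.map (fun ω => fun p : NZ × NZ => X p.1 p.2 ω) P)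
    (n : PosZ) {g : (NegZ → ℕ) → ℝ} (hg : Measurable g) {C : ℝ} (hC : ∀ x, ‖g x‖ ≤ C) :
    P[fun ω => g (fun j => X (posToNZ n) (negToNZ j) ω)|MeasurableSpace.comap
        (fun ω => fun p : {i // i ≠ posToNZ n} × {i // i ≠ posToNZ n} => X p.1 p.2 ω)
        inferInstance] =ᵐ[P]
      P[fun ω => g (fun j => X (posToNZ n) (negToNZ j) ω)|MeasurableSpace.comap
        (fun ω => fun p : NegZ × NegZ => X (negToNZ p.1) (negToNZ p.2) ω) inferInstance] := by
  set A := {i : NZ // i ≠ posToNZ n}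
  set f : Ω → ℝ := fun ω => g (fun j => X (posToNZ n) (negToNZ j) ω) with hfdef
  set η : Ω → A × A → ℕ := fun ω p => X p.1 p.2 ω with hηdef
  set θ : Ω → NegZ × NegZ → ℕ := fun ω p => X (negToNZ p.1) (negToNZ p.2) ω with hθdef
  have hη : Measurable η := measurable_pi_lambda _ fun p => hXmeas _ _
  have hθ : Measurable θ := measurable_pi_lambda _ fun p => hXmeas _ _
  have hf : Measurable f := hg.comp (measurable_pi_lambda _ fun j => hXmeas _ _)
  have hfC : ∀ ω, |f ω| ≤ C := fun ω => hC _
  have hfint : Integrable f P :=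
    Integrable.of_bound hf.aestronglyMeasurable C (Filter.Eventually.of_forall fun ω => hC _)
  let row (N : ℕ) : Ω → {j : NegZ // -(N : ℤ) ≤ j.1} → ℕ :=
    fun ω j => X (posToNZ n) (negToNZ j) ω
  have hrow (N : ℕ) : Measurable (row N) := measurable_pi_lambda _ fun j => hXmeas _ _
  let ℱ : Filtration ℕ m0 :=
    { seq := fun N => MeasurableSpace.comap (row N) inferInstance
      mono' := by
        intro N M hNM
        have : row N = (fun (x : {j : NegZ // -(M : ℤ) ≤ j.1} → ℕ)
            (j : {j : NegZ // -(N : ℤ) ≤ j.1}) => x ⟨j.1, by have := j.2; omega⟩) ∘ row M := rfl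
        refine Measurable.comap_le ?_
        rw [this]
        exact (measurable_pi_lambda _ fun j => measurable_pi_apply _).comp (comap_measurable _)
      le' := fun N => (hrow N).comap_le }
  have hfsup : StronglyMeasurable[⨆ N, ℱ N] f := by
    refine Measurable.stronglyMeasurable ?_
    refine hg.comp (@measurable_pi_lambda _ _ _ (⨆ N, ℱ N) _ _ fun j => ?_)
    have hj : -((-j.1).toNat : ℤ) ≤ j.1 := by omega
    have h1 : Measurable[ℱ (-j.1).toNat] fun ω => X (posToNZ n) (negToNZ j) ω :=
      (measurable_pi_apply (⟨j, hj⟩ : {i : NegZ // -((-j.1).toNat : ℤ) ≤ i.1})).comp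
        (comap_measurable (row (-j.1).toNat))
    exact h1.mono (le_iSup (fun N => ℱ N) _) le_rfl
  refine condExp_ae_eq_of_tendsto_eLpNorm hfint (fun N => integrable_condExp)
    (hfint.tendsto_eLpNorm_condExp hfsup) fun N => ?_
  obtain ⟨h, hh, hFh⟩ := (stronglyMeasurable_condExp
    (m := MeasurableSpace.comap (row N) inferInstance) (μ := P)
    (f := f)).exists_eq_measurable_comp
  have hFN : P[f|ℱ N] = h ∘ row N := hFh
  obtain ⟨φ, hφ, hφn, hφN, hφneg⟩ := exists_injective_fixing_maps_to_neg n N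
  let ζ : Ω → A × A → ℕ := fun ω p => X (φ p.1) (φ p.2) ω
  have hζ : Measurable ζ := measurable_pi_lambda _ fun p => hXmeas _ _
  have hζθ : MeasurableSpace.comap ζ inferInstance ≤ MeasurableSpace.comap θ inferInstance := by
    refine Measurable.comap_le (@measurable_pi_lambda _ _ _ (_) _ _ fun p => ?_)
    exact (measurable_pi_apply ((⟨(φ p.1).1, hφneg _ p.1.2⟩, ⟨(φ p.2).1, hφneg _ p.2.2⟩) :
      NegZ × NegZ)).comp (comap_measurable θ)
  have hθη : MeasurableSpace.comap θ inferInstance ≤ MeasurableSpace.comap η inferInstance :=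
    comap_negative_le_comap_ne X n
  have hlaw : P.map (fun ω => (P[f|ℱ N] ω, η ω)) = P.map (fun ω => (P[f|ℱ N] ω, ζ ω)) := by
    let Φ : (NZ × NZ → ℕ) → ℝ × (A × A → ℕ) := fun x =>
      (h fun j => x (posToNZ n, negToNZ j.1), fun p => x (p.1, p.2))
    have hΦ : Measurable Φ :=
      (hh.measurable.comp (measurable_pi_lambda _ fun j => measurable_pi_apply _)).prodMk
        (measurable_pi_lambda _ fun p => measurable_pi_apply _)
    have e := congrArg (Measure.map Φ) (map_array_comp_injective_eq hXmeas hexch hφ)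
    rw [Measure.map_map hΦ (measurable_pi_lambda _ fun p => hXmeas _ _),
      Measure.map_map hΦ (measurable_pi_lambda _ fun p => hXmeas _ _)] at e
    rw [hFN]
    refine e.symm.trans (congrArg (fun q => Measure.map q P) ?_)
    funext ω
    refine Prod.ext ?_ rfl
    change h _ = h _
    congr 1
    funext j
    change X (φ (posToNZ n)) (φ (negToNZ j.1)) ω = X (posToNZ n) (negToNZ j.1) ω
    rw [hφn, hφN _ j.2]
  have hFmeas : Measurable (P[f|ℱ N]) := by rw [hFN]; exact hh.measurable.comp (hrow N)
  have key := condExp_comap_ae_eq_of_map_eq hFmeas hη hζ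
    (ae_bdd_abs_condExp_of_ae_bdd_abs (Filter.Eventually.of_forall hfC)) (hζθ.trans hθη) hlaw
  have hmeasζ : StronglyMeasurable[MeasurableSpace.comap θ inferInstance]
      (P[P[f|ℱ N]|MeasurableSpace.comap ζ inferInstance]) :=
    stronglyMeasurable_condExp.mono hζθ
  calc P[P[f|ℱ N]|MeasurableSpace.comap η inferInstance]
      =ᵐ[P] P[P[f|ℱ N]|MeasurableSpace.comap ζ inferInstance] := key
    _ = P[P[P[f|ℱ N]|MeasurableSpace.comap ζ inferInstance]|
          MeasurableSpace.comap θ inferInstance] :=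
        (condExp_of_stronglyMeasurable hθ.comap_le hmeasζ integrable_condExp).symm
    _ =ᵐ[P] P[P[P[f|ℱ N]|MeasurableSpace.comap η inferInstance]|
          MeasurableSpace.comap θ inferInstance] := condExp_congr_ae key.symm
    _ =ᵐ[P] P[P[f|ℱ N]|MeasurableSpace.comap θ inferInstance] :=
        condExp_condExp_of_le hθη hη.comap_le

/-- For an exchangeable array indexed by `ℤ ∖ {0}`, the rows `Y_n = (X(n,j))_{j<0}`,
`n ∈ ℕ`, are conditionally independent given the σ-algebra generated by
`(X(i,j))_{i,j<0}`. -/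
theorem rows_condIndep_given_negative_part
    {Ω : Type*} [MeasurableSpace Ω] (P : Measure Ω) [IsProbabilityMeasure P]
    (X : NZ → NZ → Ω → ℕ) (hXmeas : ∀ i j, Measurable (X i j))
    (hsymm : ∀ᵐ ω ∂P, ∀ i j, X i j ω = X j i ω)
    (heven : ∀ᵐ ω ∂P, ∀ i, Even (X i i ω))
    -- exchangeability under finitely supported permutations of `ℤ ∖ {0}`
    (hexch : ∀ τ : Equiv.Perm NZ, {x | τ x ≠ x}.Finite →
      Measure.map (fun ω => fun p : NZ × NZ => X (τ p.1) (τ p.2) ω) P =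
        Measure.map (fun ω => fun p : NZ × NZ => X p.1 p.2 ω) P) :
    CondIndepFam
      (MeasurableSpace.comap
        (fun ω => fun p : NegZ × NegZ => X (negToNZ p.1) (negToNZ p.2) ω) inferInstance)
      (fun (n : PosZ) (ω : Ω) => fun j : NegZ => X (posToNZ n) (negToNZ j) ω) P := by
  intro s g hg hgC
  choose C hC using hgC
  set θ : Ω → NegZ × NegZ → ℕ := fun ω p => X (negToNZ p.1) (negToNZ p.2) ω with hθdef
  have hθ : Measurable θ := measurable_pi_lambda _ fun p => hXmeas _ _
  have hfmeas (v : PosZ) : Measurable fun ω => g v (fun j => X (posToNZ v) (negToNZ j) ω) :=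
    (hg v).comp (measurable_pi_lambda _ fun j => hXmeas _ _)
  have hfint (v : PosZ) : Integrable (fun ω => g v (fun j => X (posToNZ v) (negToNZ j) ω)) P :=
    Integrable.of_bound (hfmeas v).aestronglyMeasurable (C v)
      (Filter.Eventually.of_forall fun ω => hC v _)
  induction s using Finset.induction_on with
  | empty =>
    simp only [Finset.prod_empty]
    rw [condExp_const hθ.comap_le]
  | insert n s hn ih =>
    set f : Ω → ℝ := fun ω => g n (fun j => X (posToNZ n) (negToNZ j) ω) with hfdef
    set q : Ω → ℝ := fun ω => ∏ v ∈ s, g v (fun j => X (posToNZ v) (negToNZ j) ω) with hqdef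
    set η : Ω → {i // i ≠ posToNZ n} × {i // i ≠ posToNZ n} → ℕ := fun ω p => X p.1 p.2 ω
      with hηdef
    have hη : Measurable η := measurable_pi_lambda _ fun p => hXmeas _ _
    have hpos_ne (v : PosZ) (hv : v ∈ s) : posToNZ v ≠ posToNZ n := fun h => by
      have : v = n := Subtype.ext (congrArg (fun z : NZ => z.1) h)
      exact hn (this ▸ hv)
    have hθη : MeasurableSpace.comap θ inferInstance ≤ MeasurableSpace.comap η inferInstance :=
      comap_negative_le_comap_ne X n
    have hqη : Measurable[MeasurableSpace.comap η inferInstance] q := by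
      refine Finset.measurable_fun_prod s fun v hv => (hg v).comp
        (@measurable_pi_lambda _ _ _ (_) _ _ fun j => ?_)
      exact (measurable_pi_apply ((⟨posToNZ v, hpos_ne v hv⟩, ⟨negToNZ j, negToNZ_ne_posToNZ j n⟩) :
        {i // i ≠ posToNZ n} × {i // i ≠ posToNZ n})).comp (comap_measurable η)
    have hqC : ∀ ω, ‖q ω‖ ≤ ∏ v ∈ s, C v := fun ω => by
      rw [hqdef, norm_prod]
      exact Finset.prod_le_prod (fun v _ => norm_nonneg _) fun v _ => hC v _
    have hqm : Measurable q := hqη.mono hη.comap_le le_rfl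
    have hqint : Integrable q P := Integrable.of_bound hqm.aestronglyMeasurable _
      (Filter.Eventually.of_forall hqC)
    have hqf : Integrable (q * f) P := (hfint n).bdd_mul hqm.aestronglyMeasurable
      (Filter.Eventually.of_forall hqC)
    have hqcond : Integrable (q * P[f|MeasurableSpace.comap θ inferInstance]) P :=
      integrable_condExp.bdd_mul hqm.aestronglyMeasurable (Filter.Eventually.of_forall hqC)
    have hrow : P[f|MeasurableSpace.comap η inferInstance] =ᵐ[P]
        P[f|MeasurableSpace.comap θ inferInstance] :=
      condExp_row_eq_condExp_negative_part P X hXmeas hexch n (hg n) (hC n)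
    have hpull : P[q * f|MeasurableSpace.comap η inferInstance] =ᵐ[P]
        q * P[f|MeasurableSpace.comap θ inferInstance] :=
      (condExp_mul_of_stronglyMeasurable_left hqη.stronglyMeasurable hqf (hfint n)).trans
        (by filter_upwards [hrow] with ω hω; simp [hω])
    have hins : (fun ω => ∏ v ∈ insert n s, g v (fun j => X (posToNZ v) (negToNZ j) ω)) =
        q * f := by
      ext ω; rw [Finset.prod_insert hn, mul_comm]; rfl
    rw [hins]
    filter_upwards [condExp_condExp_of_le (f := q * f) (μ := P) hθη hη.comap_le,
      condExp_congr_ae (m := MeasurableSpace.comap θ inferInstance) hpull,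
      condExp_mul_of_stronglyMeasurable_right stronglyMeasurable_condExp hqcond hqint, ih]
      with ω h1 h2 h3 h4
    rw [← h1, h2, h3, Pi.mul_apply, h4, Finset.prod_insert hn, mul_comm]
end

section
/- Let P be a vertex exchangeable probability measure on the space A_ℕ of symmetric ℕ₀-valued arrays indexed by ℕ×ℕ with even diagonal. Then the tail σ-algebra G_∞ is P-trivial (every event in it has probability 0 or 1) if and only if P is dissociated, i.e. for every n < m the coordinates (A(i,j))_{i,j≤n} are independent of the coordinates (A(i,j))_{n<i,j≤m} under P. -/
open MeasureTheory ProbabilityTheory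

/-- `A_ℕ`: symmetric `ℕ₀`-valued arrays indexed by `ℕ × ℕ` with even diagonal,
equipped with the σ-algebra generated by the coordinates. -/
abbrev ArrSpace : Type := {A : ℕ → ℕ → ℕ // (∀ i j, A i j = A j i) ∧ ∀ i, Even (A i i)}

/-- Relabeling of the vertices by a permutation `τ` of `ℕ`. -/
def relabel (τ : Equiv.Perm ℕ) (A : ArrSpace) : ArrSpace :=
  ⟨fun i j => A.1 (τ i) (τ j), fun i j => A.2.1 (τ i) (τ j), fun i => A.2.2 (τ i)⟩

/-- The σ-algebra `G_n` generated by the coordinates `A(i,j)` with `i,j > n`. -/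
def tailAlg (n : ℕ) : MeasurableSpace ArrSpace :=
  MeasurableSpace.comap
    (fun A : ArrSpace => fun p : {p : ℕ × ℕ // n < p.1 ∧ n < p.2} => A.1 p.1.1 p.1.2)
    inferInstance

section Hilbert

open Filter Topology

variable {H : Type*} [NormedAddCommGroup H] [InnerProductSpace ℝ H] [CompleteSpace H]

/-- Projections onto a decreasing sequence of closed subspaces converge to zero on the orthogonal
complement of the intersection. -/
theorem tendsto_starProjection_zero_of_antitone (V : ℕ → Submodule ℝ H)
    [∀ n, (V n).HasOrthogonalProjection] (hV : Antitone V) {x : H} (hx : x ∈ (⨅ n, V n)ᗮ) :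
    Tendsto (fun n => (V n).starProjection x) atTop (𝓝 0) := by
  have hmono : Monotone fun n => (V n)ᗮ := fun i j hij => Submodule.orthogonal_le (hV hij)
  have hmem : x ∈ (⨆ n, (V n)ᗮ).topologicalClosure := by
    rw [← Submodule.orthogonal_orthogonal_eq_closure, ← Submodule.iInf_orthogonal]
    simpa only [Submodule.orthogonal_orthogonal] using hx
  have h := Submodule.starProjection_tendsto_closure_iSup (fun n => (V n)ᗮ) hmono x
  rw [Submodule.starProjection_eq_self_iff.mpr hmem] at h
  have h2 := h.const_sub x
  rw [sub_self] at h2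
  refine h2.congr fun n => ?_
  rw [Submodule.starProjection_orthogonal_val, sub_sub_cancel]

end Hilbert

section Reverse

open Filter Topology

variable {Ω : Type*} {m0 : MeasurableSpace Ω} {μ : Measure Ω} [IsProbabilityMeasure μ]

theorem indep_self_of_trivial {m : MeasurableSpace Ω} (hle : m ≤ m0)
    (htriv : ∀ s, MeasurableSet[m] s → μ s = 0 ∨ μ s = 1) : Indep m m μ := by
  rw [Indep_iff]
  intro s t hs ht
  rcases htriv s hs with h | h
  · rw [h, zero_mul]
    exact measure_mono_null Set.inter_subset_left h
  · rcases htriv t ht with h' | h'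
    · rw [h', mul_zero]
      exact measure_mono_null Set.inter_subset_right h'
    · rw [h, h', one_mul]
      rcases htriv (s ∩ t) (hs.inter ht) with h0 | h0
      · have hu : μ (s ∪ t) = 1 :=
          le_antisymm prob_le_one (h ▸ measure_mono Set.subset_union_left)
        have := measure_union_add_inter s (hle _ ht) (μ := μ)
        rw [hu, h0, h, h'] at this
        norm_num at this
      · exact h0

/-- A function that is a.e. measurable for each member of a decreasing sequence of σ-algebras
with trivial intersection is a.e. constant. -/
theorem ae_eq_const_of_trivial_iInf {m : ℕ → MeasurableSpace Ω} (hm : Antitone m)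
    (hle : ∀ n, m n ≤ m0)
    (htriv : ∀ s, (∀ n, MeasurableSet[m n] s) → μ s = 0 ∨ μ s = 1)
    {f : Ω → ℝ} (hfi : Integrable f μ) (hf : ∀ n, AEStronglyMeasurable[m n] f μ) :
    f =ᵐ[μ] fun _ => ∫ x, f x ∂μ := by
  choose g hg hfg using hf
  let Y : Ω → ℝ := fun x => limsup (fun n => g n x) atTop
  have hY : ∀ k, Measurable[m k] Y := by
    intro k
    have h : Measurable[m k] fun x => limsup (fun n => g (n + k) x) atTop :=
      Measurable.limsup fun n =>
        ((hg (n + k)).mono (hm (Nat.le_add_left k n))).measurable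
    have hYk : Y = fun x => limsup (fun n => g (n + k) x) atTop :=
      funext fun x => (limsup_nat_add (fun n => g n x) k).symm
    rwa [hYk]
  have hfY : f =ᵐ[μ] Y := by
    filter_upwards [ae_all_iff.mpr hfg] with x hx
    have : (fun n => g n x) = fun _ => f x := funext fun n => (hx n).symm
    simp only [Y, this, limsup_const]
  have hYinf : Measurable[⨅ n, m n] Y := fun s hs =>
    MeasurableSpace.measurableSet_iInf.mpr fun n => hY n hs
  have hinf : (⨅ n, m n) ≤ m0 := (iInf_le _ 0).trans (hle 0)
  have hind : Indep (⨅ n, m n) (⨅ n, m n) μ := indep_self_of_trivial hinf fun s hs =>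
    htriv s (MeasurableSpace.measurableSet_iInf.mp hs)
  have h1 := condExp_indep_eq hinf hinf hYinf.stronglyMeasurable hind
  rw [condExp_of_stronglyMeasurable hinf hYinf.stronglyMeasurable (hfi.congr hfY)] at h1
  rw [integral_congr_ae hfY]
  exact hfY.trans h1

/-- A decreasing sequence of σ-algebras with trivial intersection is asymptotically independent
of every event. -/
theorem tendsto_measure_inter_sub_of_trivial_iInf {m : ℕ → MeasurableSpace Ω} (hm : Antitone m)
    (hle : ∀ n, m n ≤ m0)
    (htriv : ∀ s, (∀ n, MeasurableSet[m n] s) → μ s = 0 ∨ μ s = 1)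
    {E : Set Ω} (hE : MeasurableSet E) {B : ℕ → Set Ω} (hB : ∀ n, MeasurableSet[m n] (B n)) :
    Tendsto (fun n => μ.real (E ∩ B n) - μ.real E * μ.real (B n)) atTop (𝓝 0) := by
  let V : ℕ → Submodule ℝ (Lp ℝ 2 μ) := fun n => lpMeas ℝ ℝ (m n) 2 μ
  have hproj : ∀ n, (V n).HasOrthogonalProjection := fun n => by
    have : Fact (m n ≤ m0) := ⟨hle n⟩
    have : CompleteSpace (V n) := inferInstanceAs (CompleteSpace (lpMeas ℝ ℝ (m n) 2 μ))
    infer_instance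
  have hV : Antitone V := fun i j hij f hf =>
    mem_lpMeas_iff_aestronglyMeasurable.mpr
      ((mem_lpMeas_iff_aestronglyMeasurable.mp hf).mono (hm hij))
  let ind : ∀ s : Set Ω, MeasurableSet s → Lp ℝ 2 μ := fun s hs =>
    indicatorConstLp 2 hs (measure_ne_top μ s) (1 : ℝ)
  let x : Lp ℝ 2 μ := ind E hE - μ.real E • ind Set.univ MeasurableSet.univ
  have hx : x ∈ (⨅ n, V n)ᗮ := by
    rw [Submodule.mem_orthogonal']
    intro y hy
    rw [Submodule.mem_iInf] at hy
    have hyi : Integrable y μ := (Lp.memLp y).integrable (by norm_num)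
    have hyc := ae_eq_const_of_trivial_iInf hm hle htriv hyi fun n =>
      mem_lpMeas_iff_aestronglyMeasurable.mp (hy n)
    simp only [x, ind, inner_sub_left, real_inner_smul_left, L2.inner_indicatorConstLp_one]
    rw [setIntegral_univ, integral_congr_ae (ae_restrict_of_ae hyc), setIntegral_const,
      smul_eq_mul, sub_self]
  have hlim := tendsto_starProjection_zero_of_antitone V hV hx
  have hinner : ∀ n, μ.real (E ∩ B n) - μ.real E * μ.real (B n)
      = inner ℝ ((V n).starProjection x) (ind (B n) (hle n _ (hB n))) := by
    intro n
    have hmem : ind (B n) (hle n _ (hB n)) ∈ V n :=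
      mem_lpMeas_indicatorConstLp (hle n) (hB n) (measure_ne_top μ _)
    rw [Submodule.inner_starProjection_left_eq_right,
      Submodule.starProjection_eq_self_iff.mpr hmem]
    simp only [x, ind, inner_sub_left, real_inner_smul_left,
      L2.real_inner_indicatorConstLp_one_indicatorConstLp_one, Set.univ_inter]
  refine squeeze_zero_norm (fun n => ?_) (tendsto_zero_iff_norm_tendsto_zero.mp hlim)
  rw [hinner n]
  refine (norm_inner_le_norm _ _).trans (mul_le_of_le_one_right (norm_nonneg _) ?_)
  refine norm_indicatorConstLp_le.trans ?_
  simp only [norm_one, one_mul]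
  exact Real.rpow_le_one measureReal_nonneg measureReal_le_one (by positivity)

end Reverse

/-- The involution of `ℕ` exchanging the blocks `[n, m)` and `[n + m + k, m + m + k)`. -/
def blockSwapFun (n m k i : ℕ) : ℕ :=
  if n ≤ i ∧ i < m then i + (m + k)
  else if n + (m + k) ≤ i ∧ i < m + (m + k) then i - (m + k) else i

theorem blockSwapFun_involutive (n m k : ℕ) : Function.Involutive (blockSwapFun n m k) := by
  intro i
  unfold blockSwapFun
  grind

/-- The permutation of `ℕ` exchanging the blocks `[n, m)` and `[n + m + k, m + m + k)`. -/
def blockSwap (n m k : ℕ) : Equiv.Perm ℕ := (blockSwapFun_involutive n m k).toPerm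

theorem blockSwap_apply (n m k i : ℕ) : blockSwap n m k i = blockSwapFun n m k i := rfl

theorem blockSwap_of_lt {n m k i : ℕ} (h : i < n) : blockSwap n m k i = i := by
  rw [blockSwap_apply]
  unfold blockSwapFun
  grind

theorem blockSwap_of_mem {n m k i : ℕ} (h : n ≤ i ∧ i < m) :
    blockSwap n m k i = i + (m + k) := if_pos h

theorem finite_support_blockSwap (n m k : ℕ) : {i | blockSwap n m k i ≠ i}.Finite := by
  refine (Set.finite_lt_nat (m + (m + k))).subset fun i hi => ?_
  simp only [Set.mem_ofPred_eq, blockSwap_apply, blockSwapFun] at hi ⊢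
  grind

theorem measurable_coord (i j : ℕ) : Measurable fun A : ArrSpace => A.1 i j :=
  (measurable_pi_apply j).comp ((measurable_pi_apply i).comp measurable_subtype_coe)

theorem measurable_relabel (τ : Equiv.Perm ℕ) : Measurable (relabel τ) :=
  Measurable.subtype_mk <| measurable_pi_lambda _ fun i => measurable_pi_lambda _ fun j =>
    measurable_coord (τ i) (τ j)

theorem comap_pi_le {Ω ι : Type*} {m : MeasurableSpace Ω} {f : ι → Ω → ℕ}
    (h : ∀ p, Measurable (f p)) :
    MeasurableSpace.comap (fun ω p => f p ω) inferInstance ≤ m :=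
  (measurable_pi_lambda _ h).comap_le

theorem measurable_comap_pi {Ω ι : Type*} (f : ι → Ω → ℕ) (p : ι) :
    Measurable[MeasurableSpace.comap (fun ω p => f p ω) inferInstance] (f p) :=
  (measurable_pi_apply p).comp (comap_measurable fun ω p => f p ω)

theorem measurable_coord_tailAlg {n i j : ℕ} (hi : n < i) (hj : n < j) :
    Measurable[tailAlg n] fun A : ArrSpace => A.1 i j :=
  measurable_comap_pi
    (fun (p : {p : ℕ × ℕ // n < p.1 ∧ n < p.2}) (A : ArrSpace) => A.1 p.1.1 p.1.2)
    ⟨(i, j), hi, hj⟩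

theorem tailAlg_le (n : ℕ) : tailAlg n ≤ (inferInstance : MeasurableSpace ArrSpace) :=
  comap_pi_le fun p => measurable_coord p.1.1 p.1.2

theorem antitone_tailAlg : Antitone tailAlg := fun _ _ hnk =>
  comap_pi_le fun p => measurable_coord_tailAlg (hnk.trans_lt p.2.1) (hnk.trans_lt p.2.2)

/-- The σ-algebra generated by the coordinates indexed by `S`. -/
abbrev coordAlg (S : Set (ℕ × ℕ)) : MeasurableSpace ArrSpace :=
  MeasurableSpace.comap (fun A : ArrSpace => fun p : S => A.1 p.1.1 p.1.2) inferInstance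

theorem measurable_coord_coordAlg {S : Set (ℕ × ℕ)} {i j : ℕ} (h : (i, j) ∈ S) :
    Measurable[coordAlg S] fun A : ArrSpace => A.1 i j :=
  measurable_comap_pi (fun (p : S) (A : ArrSpace) => A.1 p.1.1 p.1.2) ⟨(i, j), h⟩

theorem coordAlg_le (S : Set (ℕ × ℕ)) :
    coordAlg S ≤ (inferInstance : MeasurableSpace ArrSpace) :=
  comap_pi_le fun p => measurable_coord p.1.1 p.1.2

theorem coordAlg_mono {S T : Set (ℕ × ℕ)} (h : S ⊆ T) : coordAlg S ≤ coordAlg T :=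
  comap_pi_le fun p => measurable_coord_coordAlg (h p.2)

/-- The ambient σ-algebra is contained in any σ-algebra making all coordinates measurable. -/
theorem le_of_measurable_coord {m : MeasurableSpace ArrSpace}
    (h : ∀ i j, Measurable[m] fun A : ArrSpace => A.1 i j) :
    Subtype.instMeasurableSpace ≤ m := by
  have h' : Measurable[m] fun A : ArrSpace => A.1 :=
    @measurable_pi_lambda _ _ _ m _ _ fun i => @measurable_pi_lambda _ _ _ m _ _ fun j => h i j
  exact h'.comap_le

theorem tail_trivial_of_dissociated (P : Measure ArrSpace) [IsProbabilityMeasure P]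
    (hd : ∀ n m : ℕ, n < m → Indep (coordAlg {p | p.1 < n ∧ p.2 < n})
      (coordAlg {p | (n ≤ p.1 ∧ p.1 < m) ∧ (n ≤ p.2 ∧ p.2 < m)}) P)
    {s : Set ArrSpace} (hs : ∀ n, MeasurableSet[tailAlg n] s) : P s = 0 ∨ P s = 1 := by
  have hs0 : MeasurableSet s := tailAlg_le 0 s (hs 0)
  let F : ℕ → MeasurableSpace ArrSpace := fun n => coordAlg {p | p.1 < n ∧ p.2 < n}
  let W : ℕ → ℕ → MeasurableSpace ArrSpace := fun n k =>
    coordAlg {p | (n ≤ p.1 ∧ p.1 < n + 1 + k) ∧ (n ≤ p.2 ∧ p.2 < n + 1 + k)}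
  have htail : ∀ n, tailAlg n ≤ ⨆ k, W n k := by
    intro n
    refine comap_pi_le fun p => ?_
    obtain ⟨⟨i, j⟩, hi, hj⟩ := p
    dsimp only at hi hj ⊢
    have h : Measurable[W n (i + j)] fun A : ArrSpace => A.1 i j :=
      measurable_coord_coordAlg (by simp only [Set.mem_ofPred_eq]; omega)
    exact h.mono (le_iSup (W n) (i + j)) le_rfl
  have hFs : ∀ n, Indep (F n) (tailAlg n) P := by
    intro n
    have hW : Indep (⨆ k, W n k) (F n) P :=
      indep_iSup_of_monotone (fun k => (hd n (n + 1 + k) (by omega)).symm)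
        (fun k => coordAlg_le _) (coordAlg_le _) fun k l hkl => coordAlg_mono fun p hp => by
          simp only [Set.mem_ofPred_eq] at hp ⊢
          omega
    exact indep_of_indep_of_le_right hW.symm (htail n)
  have hsm : MeasurableSpace.generateFrom {s} ≤ (inferInstance : MeasurableSpace ArrSpace) :=
    MeasurableSpace.generateFrom_le (by rintro t rfl; exact hs0)
  have hF : Indep (⨆ n, F n) (MeasurableSpace.generateFrom {s}) P :=
    indep_iSup_of_monotone
      (fun n => indep_of_indep_of_le_right (hFs n)
        (MeasurableSpace.generateFrom_le (by rintro t rfl; exact hs n)))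
      (fun n => coordAlg_le _) hsm fun k l hkl => coordAlg_mono fun p hp => by
          simp only [Set.mem_ofPred_eq] at hp ⊢
          omega
  have htop : (inferInstance : MeasurableSpace ArrSpace) ≤ ⨆ n, F n := by
    refine le_of_measurable_coord fun i j => ?_
    have h : Measurable[F (i + j + 1)] fun A : ArrSpace => A.1 i j :=
      measurable_coord_coordAlg (by simp only [Set.mem_ofPred_eq]; omega)
    exact h.mono (le_iSup F (i + j + 1)) le_rfl
  have hself := Indep_iff _ _ P |>.mp hF s s (htop s hs0)
    (MeasurableSpace.measurableSet_generateFrom rfl)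
  exact measure_eq_zero_or_one_of_indepSet_self
    ((indepSet_iff_measure_inter_eq_mul hs0 hs0 P).mpr hself)

theorem dissociated_of_tail_trivial (P : Measure ArrSpace) [IsProbabilityMeasure P]
    (hexch : ∀ τ : Equiv.Perm ℕ, {x | τ x ≠ x}.Finite → Measure.map (relabel τ) P = P)
    (htriv : ∀ s : Set ArrSpace, (∀ n, MeasurableSet[tailAlg n] s) → P s = 0 ∨ P s = 1)
    (n m : ℕ) :
    Indep (coordAlg {p | p.1 < n ∧ p.2 < n})
      (coordAlg {p | (n ≤ p.1 ∧ p.1 < m) ∧ (n ≤ p.2 ∧ p.2 < m)}) P := by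
  rw [Indep_iff]
  intro E B hE hB
  have hE0 := coordAlg_le _ E hE
  have hB0 := coordAlg_le _ B hB
  let r : ℕ → ArrSpace → ArrSpace := fun k => relabel (blockSwap n m (k + 1))
  have hinv : ∀ k s, MeasurableSet s → P.real (r k ⁻¹' s) = P.real s := by
    intro k s hs
    have h := congrArg (fun Q : Measure ArrSpace => Q.real s)
      (hexch _ (finite_support_blockSwap n m (k + 1)))
    simpa only [map_measureReal_apply (measurable_relabel _) hs] using h
  have hrE : ∀ k, r k ⁻¹' E = E := by
    intro k
    obtain ⟨S, -, rfl⟩ := hE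
    ext A
    have : (fun p : {p : ℕ × ℕ | p.1 < n ∧ p.2 < n} => (r k A).1 p.1.1 p.1.2)
        = fun p => A.1 p.1.1 p.1.2 := by
      funext p
      simp only [r, relabel, blockSwap_of_lt p.2.1, blockSwap_of_lt p.2.2]
    simp only [Set.mem_preimage, this]
  have hrB : ∀ k, MeasurableSet[tailAlg k] (r k ⁻¹' B) := by
    intro k
    have h : @Measurable _ _ (tailAlg k)
        (coordAlg {p | (n ≤ p.1 ∧ p.1 < m) ∧ (n ≤ p.2 ∧ p.2 < m)}) (r k) := by
      refine measurable_comap_iff.mpr (@measurable_pi_lambda _ _ _ (tailAlg k) _ _ fun p => ?_)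
      simp only [Function.comp_def, r, relabel, blockSwap_of_mem p.2.1, blockSwap_of_mem p.2.2]
      exact measurable_coord_tailAlg (by omega) (by omega)
    exact h hB
  have hlim := tendsto_measure_inter_sub_of_trivial_iInf antitone_tailAlg tailAlg_le htriv hE0 hrB
  have hconst : ∀ k, P.real (E ∩ r k ⁻¹' B) - P.real E * P.real (r k ⁻¹' B)
      = P.real (E ∩ B) - P.real E * P.real B := by
    intro k
    rw [hinv k B hB0, ← hinv k (E ∩ B) (hE0.inter hB0), Set.preimage_inter, hrE k]
  simp only [hconst] at hlim
  have h0 := sub_eq_zero.mp (tendsto_nhds_unique tendsto_const_nhds hlim)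
  rw [← ENNReal.toReal_eq_toReal_iff' (measure_ne_top _ _) (by finiteness), ENNReal.toReal_mul]
  exact h0

/-- For a vertex exchangeable probability measure on `A_ℕ`, the tail σ-algebra is
trivial if and only if the measure is dissociated. -/
theorem tail_trivial_iff_dissociated (P : Measure ArrSpace) [IsProbabilityMeasure P]
    -- vertex exchangeability
    (hexch : ∀ τ : Equiv.Perm ℕ, {x | τ x ≠ x}.Finite →
      Measure.map (relabel τ) P = P) :
    -- the tail σ-algebra `G_∞ = ⋂ₙ G_n` is trivial ...
    ((∀ s : Set ArrSpace, (∀ n : ℕ, MeasurableSet[tailAlg n] s) →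
        P s = 0 ∨ P s = 1)
      ↔
    -- ... if and only if `P` is dissociated: the subarray on the first `n` indices is
    -- independent of the subarray on the indices `n+1, …, m`
    (∀ n m : ℕ, n < m →
      IndepFun
        (fun A : ArrSpace => fun p : {p : ℕ × ℕ // p.1 < n ∧ p.2 < n} => A.1 p.1.1 p.1.2)
        (fun A : ArrSpace =>
          fun p : {p : ℕ × ℕ // (n ≤ p.1 ∧ p.1 < m) ∧ (n ≤ p.2 ∧ p.2 < m)} =>
            A.1 p.1.1 p.1.2) P)) := by
  exact ⟨fun htriv n m _ => dissociated_of_tail_trivial P hexch htriv n m,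
    fun hd s hs => tail_trivial_of_dissociated P hd hs⟩
end
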